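/- Fix α ∈ (1/2, ln 3/ln 2 − 1) and let ζ = 1 − 2(2^α − 1) > 0. There exist constants θ₀ = θ₀(α) > 0, β₀ = β₀(α) > 0 (and a sufficiently large value of the nearest-neighbour coupling J(1), depending on α) such that for every field strength 0 < θ ≤ θ₀, every inverse temperature β ≥ β₀, and every finite set Λ ⊂ ℤ with 0 ∈ Λ, the annealed probability that the spin at the origin is −1 satisfies E_h[ μ⁺_Λ( { σ : σ₀ = −1 } ) ] ≤ e^{−b̄/100}, where b̄ = min(βζ/4, ζ²/(2¹⁰θ²)) and E_h denotes expectation over the random field. -/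

import Mathlib

open scoped BigOperators Classical

noncomputable section

/-- The spin value associated to a Boolean: `true ↦ +1`, `false ↦ -1`. -/
def spin (b : Bool) : ℝ := if b then 1 else -1

/-- The pair coupling: `J(1) = J₁` (a large constant) and `J(n) = n^{-(2-α)}` for `n ≥ 2`. -/
def Jcoup (J₁ α : ℝ) (n : ℕ) : ℝ := if n = 1 then J₁ else (n : ℝ) ^ (α - 2)

/-- The Hamiltonian in the finite volume `Λ ⊂ ℤ` with homogeneous boundary condition `τ`,
random field `h` and field strength `θ`:
`H^τ(σ) = (1/2) Σ_{i≠j∈Λ} J(|i-j|)(1-σᵢσⱼ) + Σ_{i∈Λ} Σ_{j∉Λ} J(|i-j|)(1-τσᵢ) - θ Σ_{i∈Λ} hᵢσᵢ`. -/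
def Ham (J₁ α θ τ : ℝ) (Λ : Finset ℤ) (h : ℤ → ℝ) (σ : Λ → Bool) : ℝ :=
  (1 / 2) * ∑ i : Λ, ∑ j : Λ, (if i = j then 0 else
      Jcoup J₁ α ((i : ℤ) - (j : ℤ)).natAbs * (1 - spin (σ i) * spin (σ j)))
  + ∑ i : Λ, (∑' j : ℤ, if j ∈ Λ then 0 else Jcoup J₁ α ((i : ℤ) - j).natAbs)
      * (1 - τ * spin (σ i))
  - θ * ∑ i : Λ, h (i : ℤ) * spin (σ i)

/-- The finite volume Gibbs probability of an event `E` at inverse temperature `β`,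
with boundary condition `τ`. -/
def gibbs (J₁ α θ τ β : ℝ) (Λ : Finset ℤ) (h : ℤ → ℝ) (E : (Λ → Bool) → Prop) : ℝ :=
  (∑ σ : Λ → Bool, if E σ then Real.exp (-β * Ham J₁ α θ τ Λ h σ) else 0) /
    ∑ σ : Λ → Bool, Real.exp (-β * Ham J₁ α θ τ Λ h σ)

/-- Expectation over the i.i.d. symmetric `±1` random field (only its restriction to `Λ`
matters, so it is an average over the `2^|Λ|` field configurations in `Λ`). -/
def fieldE (Λ : Finset ℤ) (f : (ℤ → ℝ) → ℝ) : ℝ :=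
  (1 / 2 ^ Λ.card) *
    ∑ η : Λ → Bool, f (fun i => if hi : i ∈ Λ then spin (η ⟨i, hi⟩) else 1)


lemma pk_mvt (p x : ℝ) (hx : 0 < x) :
    ∃ c ∈ Set.Ioo x (x + 1), (x + 1) ^ p - x ^ p = p * c ^ (p - 1) := by
  have h1 : x < x + 1 := by linarith
  obtain ⟨c, hc, h⟩ := exists_deriv_eq_slope (fun y : ℝ => y ^ p) h1
    (by
      intro y hy
      have : y ≠ 0 := by have := hy.1; linarith
      exact (Real.continuousAt_rpow_const y p (Or.inl this)).continuousWithinAt)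
    (by
      intro y hy
      have : y ≠ 0 := by have := hy.1; linarith
      exact (Real.differentiableAt_rpow_const_of_ne p this).differentiableWithinAt)
  refine ⟨c, hc, ?_⟩
  rw [Real.deriv_rpow_const] at h
  rw [h]
  field_simp
  ring

lemma pk_pow_lo (p x : ℝ) (hp : 0 < p) (hp1 : p < 1) (hx : 0 < x) :
    p * (x + 1) ^ (p - 1) ≤ (x + 1) ^ p - x ^ p := by
  obtain ⟨c, hc, h⟩ := pk_mvt p x hx
  rw [h]
  have : (x + 1) ^ (p - 1) ≤ c ^ (p - 1) :=
    Real.rpow_le_rpow_of_nonpos (by linarith [hc.1]) hc.2.le (by linarith)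
  nlinarith

lemma pk_pow_hi (p x : ℝ) (hp : 0 < p) (hp1 : p < 1) (hx : 0 < x) :
    (x + 1) ^ p - x ^ p ≤ p * x ^ (p - 1) := by
  obtain ⟨c, hc, h⟩ := pk_mvt p x hx
  rw [h]
  have : c ^ (p - 1) ≤ x ^ (p - 1) :=
    Real.rpow_le_rpow_of_nonpos (by linarith [hc.1]) hc.1.le (by linarith)
  nlinarith

lemma pk_neg_lo (α x : ℝ) (h1 : α < 1) (hx : 0 < x) :
    (1 - α) * (x + 1) ^ (α - 2) ≤ x ^ (α - 1) - (x + 1) ^ (α - 1) := by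
  obtain ⟨c, hc, h⟩ := pk_mvt (α - 1) x hx
  have e : α - 1 - 1 = α - 2 := by ring
  rw [e] at h
  have : (x + 1) ^ (α - 2) ≤ c ^ (α - 2) :=
    Real.rpow_le_rpow_of_nonpos (by linarith [hc.1]) hc.2.le (by linarith)
  nlinarith

lemma pk_neg_hi (α x : ℝ) (h1 : α < 1) (hx : 0 < x) :
    x ^ (α - 1) - (x + 1) ^ (α - 1) ≤ (1 - α) * x ^ (α - 2) := by
  obtain ⟨c, hc, h⟩ := pk_mvt (α - 1) x hx
  have e : α - 1 - 1 = α - 2 := by ring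
  rw [e] at h
  have : c ^ (α - 2) ≤ x ^ (α - 2) :=
    Real.rpow_le_rpow_of_nonpos (by linarith [hc.1]) hc.1.le (by linarith)
  nlinarith

lemma Jcoup_nonneg (J₁ α : ℝ) (hJ : 0 ≤ J₁) (n : ℕ) : 0 ≤ Jcoup J₁ α n := by
  unfold Jcoup
  split_ifs
  · exact hJ
  · positivity

lemma Jcoup_zero (J₁ α : ℝ) (h1 : α < 1) : Jcoup J₁ α 0 = 0 := by
  unfold Jcoup
  simp
  rw [Real.zero_rpow]
  linarith

lemma Jcoup_summable (J₁ α : ℝ) (h1 : α < 1) : Summable (Jcoup J₁ α) := by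
  rw [← summable_nat_add_iff 2]
  have : Summable (fun n : ℕ => ((n : ℝ)) ^ (α - 2)) := by
    rw [Real.summable_nat_rpow]; linarith
  rw [← summable_nat_add_iff 2] at this
  refine this.congr ?_
  intro n
  unfold Jcoup
  rw [if_neg (by omega)]

/-- tail sums of the coupling -/
def tailJ (J₁ α : ℝ) (n : ℕ) : ℝ := ∑' k : ℕ, Jcoup J₁ α (k + n)

lemma tailJ_rec (J₁ α : ℝ) (h1 : α < 1) (n : ℕ) :
    tailJ J₁ α n = Jcoup J₁ α n + tailJ J₁ α (n + 1) := by
  unfold tailJ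
  have hs := (summable_nat_add_iff n).2 (Jcoup_summable J₁ α h1)
  rw [hs.tsum_eq_zero_add]
  simp [add_comm, add_left_comm]

lemma tailJ_nonneg (J₁ α : ℝ) (hJ : 0 ≤ J₁) (n : ℕ) : 0 ≤ tailJ J₁ α n :=
  tsum_nonneg fun _ => Jcoup_nonneg _ _ hJ _

lemma tailJ_hi (J₁ α : ℝ) (h1 : α < 1) (n : ℕ) (hn : 1 ≤ n) (hJ : 0 ≤ J₁) :
    tailJ J₁ α (n + 1) ≤ (n : ℝ) ^ (α - 1) / (1 - α) := by
  have h1' : 0 < 1 - α := by linarith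
  unfold tailJ
  apply Real.tsum_le_of_sum_range_le (fun k => Jcoup_nonneg _ _ hJ _)
  intro m
  have key : ∑ k ∈ Finset.range m, Jcoup J₁ α (k + (n + 1)) ≤
      ((n : ℝ) ^ (α - 1) - ((n : ℝ) + m) ^ (α - 1)) / (1 - α) := by
    induction m with
    | zero => simp
    | succ m ih =>
      rw [Finset.sum_range_succ]
      have h := pk_neg_lo α ((n : ℝ) + m) h1 (by positivity)
      have e : Jcoup J₁ α (m + (n + 1)) = ((n : ℝ) + m + 1) ^ (α - 2) := by
        unfold Jcoup
        rw [if_neg (by omega)]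
        push_cast
        congr 1
        ring
      rw [e]
      rw [le_div_iff₀ h1'] at *
      push_cast
      rw [← add_assoc]
      nlinarith
  refine key.trans ?_
  gcongr
  have : (0 : ℝ) ≤ ((n : ℝ) + m) ^ (α - 1) := by positivity
  linarith

lemma tailJ_lo (J₁ α : ℝ) (h1 : α < 1) (n : ℕ) (hn : 2 ≤ n) :
    (n : ℝ) ^ (α - 1) / (1 - α) ≤ tailJ J₁ α n := by
  have h1' : 0 < 1 - α := by linarith
  have hs := (summable_nat_add_iff n).2 (Jcoup_summable J₁ α h1)
  have ht := hs.hasSum.tendsto_sum_nat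
  have key : ∀ m : ℕ, ((n : ℝ) ^ (α - 1) - ((m : ℝ) + n) ^ (α - 1)) / (1 - α) ≤
      ∑ k ∈ Finset.range m, Jcoup J₁ α (k + n) := by
    intro m
    induction m with
    | zero => simp
    | succ m ih =>
      rw [Finset.sum_range_succ]
      have h := pk_neg_hi α ((m : ℝ) + n) h1 (by positivity)
      have e : Jcoup J₁ α (m + n) = ((m : ℝ) + n) ^ (α - 2) := by
        unfold Jcoup
        rw [if_neg (by omega)]
        push_cast
        congr 1
      rw [e]
      rw [div_le_iff₀ h1'] at *
      push_cast
      have e2 : (m : ℝ) + 1 + n = m + n + 1 := by ring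
      rw [e2]
      nlinarith
  have hlim : Filter.Tendsto (fun m : ℕ => ((n : ℝ) ^ (α - 1) - ((m : ℝ) + n) ^ (α - 1)) / (1 - α))
      Filter.atTop (nhds (((n : ℝ) ^ (α - 1) - 0) / (1 - α))) := by
    apply Filter.Tendsto.div_const
    apply Filter.Tendsto.sub tendsto_const_nhds
    have h2 : Filter.Tendsto (fun x : ℝ => x ^ (-(1 - α))) Filter.atTop (nhds 0) :=
      tendsto_rpow_neg_atTop h1'
    have h3 : Filter.Tendsto (fun m : ℕ => (m : ℝ) + n) Filter.atTop Filter.atTop :=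
      Filter.tendsto_atTop_add_const_right _ _ tendsto_natCast_atTop_atTop
    have := h2.comp h3
    refine this.congr ?_
    intro m
    simp only [Function.comp]
    congr 1
    ring
  have := le_of_tendsto_of_tendsto' hlim ht key
  simpa [tailJ] using this

lemma tailJ_one (J₁ α : ℝ) (h1 : α < 1) (hJ : 0 ≤ J₁) : J₁ ≤ tailJ J₁ α 1 := by
  rw [tailJ_rec J₁ α h1]
  have := tailJ_nonneg J₁ α hJ (1+1)
  have e : Jcoup J₁ α 1 = J₁ := by simp [Jcoup]
  linarith

lemma tail_sum_lo (J₁ α : ℝ) (h0 : 0 < α) (h1 : α < 1) (hJ : 0 ≤ J₁) (L : ℕ) (hL : 1 ≤ L) :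
    J₁ + ((L : ℝ) ^ α - 2) / (α * (1 - α)) ≤ ∑ k ∈ Finset.Icc 1 L, tailJ J₁ α k := by
  have h1' : 0 < 1 - α := by linarith
  have h2 : 0 < α * (1 - α) := by positivity
  have key : J₁ + (((L : ℝ) + 1) ^ α - 2 ^ α) / (α * (1 - α)) ≤
      ∑ k ∈ Finset.Icc 1 L, tailJ J₁ α k := by
    induction L, hL using Nat.le_induction with
    | base =>
      have : ((1 : ℕ) : ℝ) + 1 = 2 := by norm_num
      rw [this]
      simpa using tailJ_one J₁ α h1 hJ
    | succ L hL ih =>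
      rw [Finset.sum_Icc_succ_top (by omega)]
      have h := pk_pow_hi α ((L : ℝ) + 1) h0 h1 (by positivity)
      have h3 := tailJ_lo J₁ α h1 (L + 1) (by omega)
      push_cast at *
      have e : ((L : ℝ) + 1 + 1) ^ α - 2 ^ α = (((L : ℝ) + 1) ^ α - 2 ^ α) +
        (((L : ℝ) + 1 + 1) ^ α - ((L : ℝ) + 1) ^ α) := by ring
      rw [e, add_div]
      have : (((L : ℝ) + 1 + 1) ^ α - ((L : ℝ) + 1) ^ α) / (α * (1 - α)) ≤
          ((L : ℝ) + 1) ^ (α - 1) / (1 - α) := by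
        rw [div_le_div_iff₀ h2 h1']
        nlinarith
      linarith
  refine le_trans ?_ key
  gcongr
  · linarith
  · calc (2 : ℝ) ^ α ≤ 2 ^ (1 : ℝ) := Real.rpow_le_rpow_of_exponent_le (by norm_num) h1.le
      _ = 2 := by simp

lemma tail_sum_hi (J₁ α : ℝ) (h0 : 0 < α) (h1 : α < 1) (hJ : 0 ≤ J₁) (L : ℕ) (hL : 1 ≤ L) :
    ∑ k ∈ Finset.Icc 1 L, tailJ J₁ α (k + L) ≤
      (1 + (2 ^ α - 1) * (L : ℝ) ^ α / α) / (1 - α) := by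
  have h1' : 0 < 1 - α := by linarith
  have key : ∀ M : ℕ, 1 ≤ M → ∑ k ∈ Finset.Icc 1 M, tailJ J₁ α (k + L) ≤
      (1 + (((L : ℝ) + M - 1) ^ α - (L : ℝ) ^ α) / α) / (1 - α) := by
    intro M hM
    induction M, hM using Nat.le_induction with
    | base =>
      have e : (L : ℝ) + (1 : ℕ) - 1 = L := by push_cast; ring
      rw [e]
      simp only [Finset.Icc_self, Finset.sum_singleton, sub_self, zero_div, add_zero]
      rw [add_comm]
      refine (tailJ_hi J₁ α h1 L hL hJ).trans ?_
      gcongr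
      exact Real.rpow_le_one_of_one_le_of_nonpos (by exact_mod_cast hL) (by linarith)
    | succ M hM ih =>
      rw [Finset.sum_Icc_succ_top (by omega)]
      have h3 := tailJ_hi J₁ α h1 (M + L) (by omega) hJ
      have e : M + 1 + L = M + L + 1 := by ring
      rw [e]
      have hpos : 0 < (L : ℝ) + M - 1 := by
        have : (1 : ℝ) ≤ L := by exact_mod_cast hL
        have : (1 : ℝ) ≤ M := by exact_mod_cast hM
        linarith
      have h := pk_pow_lo α ((L : ℝ) + M - 1) h0 h1 hpos
      have e2 : (L : ℝ) + M - 1 + 1 = M + L := by ring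
      have e3 : (L : ℝ) + ((M + 1 : ℕ) : ℝ) - 1 = M + L := by push_cast; ring
      rw [e2] at h
      rw [e3]
      push_cast at h3
      have h4 : ((M : ℝ) + L) ^ (α - 1) ≤
          (((M : ℝ) + L) ^ α - ((L : ℝ) + M - 1) ^ α) / α := by
        rw [le_div_iff₀ h0]; linarith
      have h5 : ((M : ℝ) + L) ^ (α - 1) / (1 - α) ≤
          (((M : ℝ) + L) ^ α - ((L : ℝ) + M - 1) ^ α) / α / (1 - α) := by gcongr
      calc _ ≤ (1 + (((L : ℝ) + M - 1) ^ α - (L : ℝ) ^ α) / α) / (1 - α) +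
          (((M : ℝ) + L) ^ α - ((L : ℝ) + M - 1) ^ α) / α / (1 - α) := by linarith
        _ = _ := by ring
  refine (key L hL).trans ?_
  gcongr
  have : ((L : ℝ) + L - 1) ^ α ≤ (2 * L) ^ α := by
    have : (1 : ℝ) ≤ L := by exact_mod_cast hL
    apply Real.rpow_le_rpow (by linarith) (by linarith) h0.le
  rw [Real.mul_rpow (by norm_num) (by positivity)] at this
  linarith

/-- main energy estimate for tails -/
lemma tail_main (J₁ α ζ : ℝ) (h0 : 0 < α) (h1 : α < 1) (hJ : 0 ≤ J₁)
    (hζ : ζ = 1 - 2 * ((2 : ℝ) ^ α - 1)) (L : ℕ) (hL : 1 ≤ L) :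
    J₁ + (ζ * (L : ℝ) ^ α - 4) / (α * (1 - α)) ≤
      ∑ k ∈ Finset.Icc 1 L, (tailJ J₁ α k - 2 * tailJ J₁ α (k + L)) := by
  have h1' : 0 < 1 - α := by linarith
  rw [Finset.sum_sub_distrib, ← Finset.mul_sum]
  have a := tail_sum_lo J₁ α h0 h1 hJ L hL
  have b := tail_sum_hi J₁ α h0 h1 hJ L hL
  have e : (1 + (2 ^ α - 1) * (L : ℝ) ^ α / α) / (1 - α) =
    (α + (2 ^ α - 1) * (L : ℝ) ^ α) / (α * (1 - α)) := by field_simp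
  rw [e] at b
  have : (ζ * (L : ℝ) ^ α - 4) / (α * (1 - α)) ≤ ((L : ℝ) ^ α - 2) / (α * (1 - α))
      - 2 * ((α + (2 ^ α - 1) * (L : ℝ) ^ α) / (α * (1 - α))) := by
    rw [← mul_div_assoc, ← sub_div]
    refine div_le_div_of_nonneg_right ?_ (by positivity)
    rw [hζ]
    nlinarith
  linarith

lemma tail_harm (J₁ α : ℝ) (h0 : 0 < α) (h1 : α < 1) (hJ : 0 ≤ J₁) (L : ℕ) (hL : 1 ≤ L) :
    ∑ d ∈ Finset.Icc 1 L, tailJ J₁ α (max d 2) ≤ 3 * (L : ℝ) ^ α / (α * (1 - α)) := by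
  have h1' : 0 < 1 - α := by linarith
  have h2 : 0 < α * (1 - α) := by positivity
  have t2 : tailJ J₁ α 2 ≤ 1 / (1 - α) := by
    have := tailJ_hi J₁ α h1 1 le_rfl hJ
    simpa using this
  have t2' : tailJ J₁ α 2 ≤ 1 / (α * (1 - α)) := by
    refine t2.trans ?_
    apply one_div_le_one_div_of_le h2
    nlinarith
  have key : ∑ d ∈ Finset.Icc 1 (L + 1), tailJ J₁ α (max d 2) ≤ (2 + (L : ℝ) ^ α) / (α * (1 - α)) := by
    induction L, hL using Nat.le_induction with
    | base =>
      rw [Finset.sum_Icc_succ_top (by omega)]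
      simp only [Finset.Icc_self, Finset.sum_singleton]
      norm_num
      norm_num at t2'
      calc _ ≤ 3 * (α * (1 - α))⁻¹ := by
            rw [mul_inv]
            have : 0 < (α * (1 - α))⁻¹ := by positivity
            rw [mul_inv] at this
            linarith
        _ = _ := by ring
    | succ L hL ih =>
      rw [Finset.sum_Icc_succ_top (by omega)]
      have e : max (L + 1 + 1) 2 = (L + 1) + 1 := by omega
      rw [e]
      have h3 := tailJ_hi J₁ α h1 (L + 1) (by omega) hJ
      have h := pk_pow_lo α (L : ℝ) h0 h1 (by exact_mod_cast hL)
      push_cast at *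
      have : ((L : ℝ) + 1) ^ (α - 1) / (1 - α) ≤ (((L : ℝ) + 1) ^ α - (L : ℝ) ^ α) / (α * (1 - α)) := by
        rw [div_le_div_iff₀ h1' h2]
        nlinarith
      calc _ ≤ (2 + (L : ℝ) ^ α) / (α * (1 - α)) + (((L : ℝ) + 1) ^ α - (L : ℝ) ^ α) / (α * (1 - α)) := by
            linarith
        _ = _ := by ring
  have hmono : ∑ d ∈ Finset.Icc 1 L, tailJ J₁ α (max d 2) ≤
      ∑ d ∈ Finset.Icc 1 (L + 1), tailJ J₁ α (max d 2) :=
    Finset.sum_le_sum_of_subset_of_nonneg (Finset.Icc_subset_Icc le_rfl (by omega))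
      (fun _ _ _ => tailJ_nonneg _ _ hJ _)
  refine hmono.trans (key.trans ?_)
  gcongr
  have : (1 : ℝ) ≤ (L : ℝ) ^ α := Real.one_le_rpow (by exact_mod_cast hL) h0.le
  linarith


/-- coupling as an even function on the integers -/
def jz (J₁ α : ℝ) (n : ℤ) : ℝ := Jcoup J₁ α n.natAbs
/-- tail as a function on the integers -/
def tz (J₁ α : ℝ) (n : ℤ) : ℝ := tailJ J₁ α n.toNat
/-- interaction of a site with a set -/
def qs (J₁ α : ℝ) (x : ℤ) (B : Finset ℤ) : ℝ := ∑ y ∈ B, jz J₁ α (y - x)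
/-- energy of a minus set -/
def WW (J₁ α : ℝ) (A : Finset ℤ) : ℝ :=
  2 * tailJ J₁ α 1 * A.card - ∑ x ∈ A, qs J₁ α x A

lemma jz_neg (J₁ α : ℝ) (n : ℤ) : jz J₁ α (-n) = jz J₁ α n := by simp [jz]
lemma jz_comm (J₁ α : ℝ) (x y : ℤ) : jz J₁ α (x - y) = jz J₁ α (y - x) := by
  rw [← jz_neg]; congr 1; ring
lemma jz_nonneg (J₁ α : ℝ) (hJ : 0 ≤ J₁) (n : ℤ) : 0 ≤ jz J₁ α n := Jcoup_nonneg _ _ hJ _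
lemma jz_zero (J₁ α : ℝ) (h1 : α < 1) : jz J₁ α 0 = 0 := Jcoup_zero _ _ h1
lemma tz_nonneg (J₁ α : ℝ) (hJ : 0 ≤ J₁) (n : ℤ) : 0 ≤ tz J₁ α n := tailJ_nonneg _ _ hJ _
lemma tz_rec (J₁ α : ℝ) (h1 : α < 1) (n : ℤ) (hn : 0 ≤ n) :
    tz J₁ α n = jz J₁ α n + tz J₁ α (n + 1) := by
  lift n to ℕ using hn
  unfold tz jz
  rw [show ((n : ℤ) + 1).toNat = n + 1 by omega]
  simpa using tailJ_rec J₁ α h1 n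

lemma qs_nonneg (J₁ α : ℝ) (hJ : 0 ≤ J₁) (x : ℤ) (B : Finset ℤ) : 0 ≤ qs J₁ α x B :=
  Finset.sum_nonneg fun _ _ => jz_nonneg _ _ hJ _
lemma qs_mono (J₁ α : ℝ) (hJ : 0 ≤ J₁) (x : ℤ) {B C : Finset ℤ} (h : B ⊆ C) :
    qs J₁ α x B ≤ qs J₁ α x C :=
  Finset.sum_le_sum_of_subset_of_nonneg h fun _ _ _ => jz_nonneg _ _ hJ _
lemma qs_union (J₁ α : ℝ) (x : ℤ) {B C : Finset ℤ} (h : Disjoint B C) :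
    qs J₁ α x (B ∪ C) = qs J₁ α x B + qs J₁ α x C := Finset.sum_union h
lemma qs_comm (J₁ α : ℝ) (A B : Finset ℤ) :
    ∑ x ∈ A, qs J₁ α x B = ∑ y ∈ B, qs J₁ α y A := by
  unfold qs
  rw [Finset.sum_comm]
  exact Finset.sum_congr rfl fun _ _ => Finset.sum_congr rfl fun _ _ => jz_comm _ _ _ _

lemma qs_right (J₁ α : ℝ) (h1 : α < 1) (x u v : ℤ) (hu : x ≤ u) (hv : u ≤ v) :
    qs J₁ α x (Finset.Ico u v) = tz J₁ α (u - x) - tz J₁ α (v - x) := by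
  induction v, hv using Int.leInduction with
  | base => simp [qs]
  | succ v hv ih =>
    have e : Finset.Ico u (v + 1) = insert v (Finset.Ico u v) := by
      ext y; simp; omega
    unfold qs at *
    rw [e, Finset.sum_insert (by simp), ih, tz_rec J₁ α h1 (v - x) (by omega)]
    rw [show v + 1 - x = v - x + 1 by ring]
    ring

lemma qs_left (J₁ α : ℝ) (h1 : α < 1) (x u v : ℤ) (hv : v ≤ x + 1) (hu : u ≤ v) :
    qs J₁ α x (Finset.Ico u v) = tz J₁ α (x - v + 1) - tz J₁ α (x - u + 1) := by
  have := qs_right J₁ α h1 (-x) (-v + 1) (-u + 1) (by omega) (by omega)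
  rw [show x - v + 1 = -v + 1 - -x by ring, show x - u + 1 = -u + 1 - -x by ring, ← this]
  unfold qs
  apply Finset.sum_nbij' (fun y => -y) (fun y => -y)
  · intro y; simp; omega
  · intro y; simp; omega
  · simp
  · simp
  · intro y _
    rw [show -y - -x = -(y - x) by ring, jz_neg]

lemma qs_le (J₁ α : ℝ) (h1 : α < 1) (hJ : 0 ≤ J₁) (x : ℤ) (B : Finset ℤ) :
    qs J₁ α x B ≤ 2 * tailJ J₁ α 1 := by
  obtain ⟨M, hM⟩ : ∃ M : ℤ, 0 ≤ M ∧ ∀ y ∈ B, |y - x| ≤ M := by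
    refine ⟨∑ y ∈ B, |y - x|, Finset.sum_nonneg fun _ _ => abs_nonneg _, fun y hy => ?_⟩
    exact Finset.single_le_sum (f := fun y => |y - x|) (fun _ _ => abs_nonneg _) hy
  have hs : B ⊆ Finset.Ico (x - M) (x + 1) ∪ Finset.Ico (x + 1) (x + M + 1) := by
    intro y hy
    have := abs_le.1 (hM.2 y hy)
    simp; omega
  refine (qs_mono J₁ α hJ x hs).trans ?_
  rw [qs_union]
  · rw [qs_left J₁ α h1 _ _ _ le_rfl (by omega), qs_right J₁ α h1 _ _ _ (by omega) (by omega)]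
    have e1 : tz J₁ α (x - (x + 1) + 1) = tailJ J₁ α 1 := by
      rw [show x - (x + 1) + 1 = 0 by ring, tz_rec J₁ α h1 _ le_rfl, jz_zero _ _ h1]
      simp [tz]
    have e2 : tz J₁ α (x + 1 - x) = tailJ J₁ α 1 := by
      rw [show x + 1 - x = 1 by ring]; rfl
    rw [e1, e2]
    have := tz_nonneg J₁ α hJ (x - (x - M) + 1)
    have := tz_nonneg J₁ α hJ (x + M + 1 - x)
    linarith
  · rw [Finset.disjoint_left]; intro y; simp; omega

/-- flipping formula -/
lemma gain_formula (J₁ α : ℝ) (A T : Finset ℤ) :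
    WW J₁ α A - WW J₁ α (symmDiff A T) =
      ∑ x ∈ T, (if x ∈ A then (1 : ℝ) else -1) *
        (2 * tailJ J₁ α 1 - qs J₁ α x T - 2 * qs J₁ α x (A \ T)) := by
  set U := A \ T with hU
  set V := A ∩ T with hV
  set V' := T \ A with hV'
  have dUV : Disjoint U V := by rw [Finset.disjoint_left]; intro x; simp [U, V]; tauto
  have dUV' : Disjoint U V' := by rw [Finset.disjoint_left]; intro x; simp [U, V']; tauto
  have dVV' : Disjoint V V' := by rw [Finset.disjoint_left]; intro x; simp [V, V']; tauto
  have eA : A = U ∪ V := by ext x; simp [U, V]; tauto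
  have eS : symmDiff A T = U ∪ V' := by
    ext x; simp [U, V', Finset.mem_symmDiff]
  have eT : T = V ∪ V' := by ext x; simp [V, V']; tauto
  have r : ∑ x ∈ T, (if x ∈ A then (1 : ℝ) else -1) *
        (2 * tailJ J₁ α 1 - qs J₁ α x T - 2 * qs J₁ α x U) =
      ∑ x ∈ V, (2 * tailJ J₁ α 1 - qs J₁ α x T - 2 * qs J₁ α x U) -
      ∑ x ∈ V', (2 * tailJ J₁ α 1 - qs J₁ α x T - 2 * qs J₁ α x U) := by
    conv_lhs => rw [show (∑ x ∈ T, (if x ∈ A then (1 : ℝ) else -1) *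
        (2 * tailJ J₁ α 1 - qs J₁ α x T - 2 * qs J₁ α x U)) = ∑ x ∈ V ∪ V', (if x ∈ A then (1 : ℝ) else -1) *
        (2 * tailJ J₁ α 1 - qs J₁ α x T - 2 * qs J₁ α x U) by rw [← eT]]
    rw [Finset.sum_union dVV', sub_eq_add_neg, ← Finset.sum_neg_distrib]
    congr 1
    · apply Finset.sum_congr rfl
      intro x hx
      rw [if_pos (Finset.mem_inter.1 hx).1, one_mul]
    · apply Finset.sum_congr rfl
      intro x hx
      rw [if_neg (Finset.mem_sdiff.1 hx).2]; ring
  rw [r]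
  have eqT : ∀ x, qs J₁ α x T = qs J₁ α x V + qs J₁ α x V' := by
    intro x; rw [← qs_union _ _ _ dVV', ← eT]
  simp only [eqT]
  rw [eS]
  have eW : WW J₁ α A = WW J₁ α (U ∪ V) := by rw [← eA]
  rw [eW]
  unfold WW
  rw [Finset.card_union_of_disjoint dUV, Finset.card_union_of_disjoint dUV',
    Finset.sum_union dUV, Finset.sum_union dUV']
  simp only [qs_union _ _ _ dUV, qs_union _ _ _ dUV', Finset.sum_add_distrib,
    Finset.sum_sub_distrib, Finset.sum_const, nsmul_eq_mul, ← Finset.mul_sum]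
  rw [qs_comm J₁ α U V, qs_comm J₁ α U V', qs_comm J₁ α V' V]
  push_cast
  ring


lemma tailJ_anti (J₁ α : ℝ) (h1 : α < 1) (hJ : 0 ≤ J₁) : Antitone (tailJ J₁ α) := by
  apply antitone_nat_of_succ_le
  intro n
  rw [tailJ_rec J₁ α h1 n]
  have := Jcoup_nonneg J₁ α hJ n
  linarith

lemma abel_density (f : ℕ → ℝ) (hf : Antitone f) (hf0 : ∀ n, 0 ≤ f n) (ε : ℝ) (Z : Finset ℤ)
    (δ : ℤ → ℕ) (hδ : ∀ z ∈ Z, 1 ≤ δ z) (L : ℕ)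
    (hd : ∀ d : ℕ, 1 ≤ d → d ≤ L → ((Z.filter fun z => δ z ≤ d).card : ℝ) ≤ ε * d) :
    ∑ z ∈ Z.filter (fun z => δ z ≤ L), f (δ z) ≤ ε * ∑ d ∈ Finset.Icc 1 L, f d := by
  have key : ∀ M : ℕ, M ≤ L → ∑ z ∈ Z.filter (fun z => δ z ≤ M), f (δ z) +
      (ε * M - ((Z.filter fun z => δ z ≤ M).card : ℝ)) * f M ≤ ε * ∑ d ∈ Finset.Icc 1 M, f d := by
    intro M
    induction M with
    | zero =>
      intro _
      have : Z.filter (fun z => δ z ≤ 0) = ∅ := by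
        rw [Finset.filter_eq_empty_iff]
        intro z hz; have := hδ z hz; omega
      rw [this]; simp
    | succ M ih =>
      intro hM
      have ih := ih (by omega)
      have e : Z.filter (fun z => δ z ≤ M + 1) =
          Z.filter (fun z => δ z ≤ M) ∪ Z.filter (fun z => δ z = M + 1) := by
        ext z; simp only [Finset.mem_filter, Finset.mem_union]
        constructor
        · rintro ⟨h, h2⟩; rcases Nat.lt_or_ge (δ z) (M + 1) with h3 | h3
          · left; exact ⟨h, by omega⟩
          · right; exact ⟨h, by omega⟩
        · rintro (⟨h, h2⟩ | ⟨h, h2⟩) <;> exact ⟨h, by omega⟩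
      have dj : Disjoint (Z.filter (fun z => δ z ≤ M)) (Z.filter (fun z => δ z = M + 1)) := by
        rw [Finset.disjoint_left]; intro z; simp; intro _ h _; omega
      rw [e, Finset.sum_union dj, Finset.card_union_of_disjoint dj,
        Finset.sum_Icc_succ_top (by omega)]
      have e2 : ∑ z ∈ Z.filter (fun z => δ z = M + 1), f (δ z) =
          ((Z.filter (fun z => δ z = M + 1)).card : ℝ) * f (M + 1) := by
        rw [← nsmul_eq_mul, ← Finset.sum_const]
        apply Finset.sum_congr rfl
        intro z hz; rw [(Finset.mem_filter.1 hz).2]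
      rw [e2]
      have hpos : 0 ≤ ε * M - ((Z.filter fun z => δ z ≤ M).card : ℝ) := by
        rcases Nat.eq_zero_or_pos M with h | h
        · subst h
          have : Z.filter (fun z => δ z ≤ 0) = ∅ := by
            rw [Finset.filter_eq_empty_iff]
            intro z hz; have := hδ z hz; omega
          rw [this]; simp
        · linarith [hd M h (by omega)]
      have hmono := mul_le_mul_of_nonneg_left (hf (Nat.le_succ M)) hpos
      simp only [Nat.succ_eq_add_one] at hmono
      push_cast
      linarith
  have h := key L le_rfl
  have hpos : 0 ≤ (ε * L - ((Z.filter fun z => δ z ≤ L).card : ℝ)) * f L := by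
    apply mul_nonneg _ (hf0 L)
    rcases Nat.eq_zero_or_pos L with h | h
    · subst h
      have : Z.filter (fun z => δ z ≤ 0) = ∅ := by
        rw [Finset.filter_eq_empty_iff]
        intro z hz; have := hδ z hz; omega
      rw [this]; simp
    · linarith [hd L h le_rfl]
  linarith

/-- distance of a site (as unit cell) to the dual point `e` -/
def dpt (e z : ℤ) : ℕ := if e ≤ z then (z - e + 1).toNat else (e - z).toNat

lemma dpt_le (e z : ℤ) (d : ℕ) : dpt e z ≤ d ↔ z ∈ Finset.Ico (e - d) (e + d) := by
  unfold dpt; simp; split_ifs <;> omega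

lemma dpt_pos (e z : ℤ) : 1 ≤ dpt e z := by
  unfold dpt; split_ifs <;> omega

lemma harm_point (J₁ α : ℝ) (h0 : 0 < α) (h1 : α < 1) (hJ : 0 ≤ J₁) (ε : ℝ) (hε0 : 0 ≤ ε)
    (hε : ε < 1)
    (D : Finset ℤ) (e : ℤ) (L : ℕ) (hL : 1 ≤ L)
    (hd : ∀ d : ℕ, 1 ≤ d → d ≤ L → ((D ∩ Finset.Ico (e - d) (e + d)).card : ℝ) ≤ ε * d) :
    ∑ z ∈ D ∩ Finset.Ico (e - L) (e + L), tailJ J₁ α (dpt e z) ≤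
      ε * (3 * (L : ℝ) ^ α / (α * (1 - α))) := by
  have ef : ∀ d : ℕ, D.filter (fun z => dpt e z ≤ d) = D ∩ Finset.Ico (e - d) (e + d) := by
    intro d; ext z; simp only [Finset.mem_filter, Finset.mem_inter, dpt_le]
  have h := abel_density (fun d => tailJ J₁ α (max d 2))
    (fun a b hab => tailJ_anti J₁ α h1 hJ (by simp; omega))
    (fun n => tailJ_nonneg _ _ hJ _) ε D (dpt e) (fun z _ => dpt_pos e z) L
    (by intro d hd1 hd2; rw [ef]; exact hd d hd1 hd2)
  rw [ef] at h
  have hno : D.filter (fun z => dpt e z ≤ 1) = ∅ := by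
    rw [ef]
    have := hd 1 le_rfl hL
    rw [← Finset.card_eq_zero]
    by_contra hne
    have : (1 : ℝ) ≤ ((D ∩ Finset.Ico (e - (1 : ℕ)) (e + (1 : ℕ))).card : ℝ) := by
      exact_mod_cast Nat.one_le_iff_ne_zero.2 hne
    push_cast at *
    linarith
  calc _ = ∑ z ∈ D ∩ Finset.Ico (e - L) (e + L), tailJ J₁ α (max (dpt e z) 2) := by
        apply Finset.sum_congr rfl
        intro z hz
        have h2 : ¬ dpt e z ≤ 1 := by
          intro hh
          have : z ∈ D.filter (fun z => dpt e z ≤ 1) :=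
            Finset.mem_filter.2 ⟨(Finset.mem_inter.1 hz).1, hh⟩
          rw [hno] at this; simp at this
        rw [max_eq_left (by omega)]
    _ ≤ _ := h
    _ ≤ _ := mul_le_mul_of_nonneg_left (tail_harm J₁ α h0 h1 hJ L hL) hε0

/-- pointwise lower bound -/
lemma point_lower (J₁ α : ℝ) (h1 : α < 1) (hJ : 0 ≤ J₁) (A T N : Finset ℤ) (x : ℤ)
    (hTN : Disjoint T N) :
    qs J₁ α x T + 2 * qs J₁ α x (N.filter fun y => (y ∈ A ↔ ¬ x ∈ A)) - 2 * tailJ J₁ α 1 ≤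
    (if x ∈ A then (1 : ℝ) else -1) *
        (2 * tailJ J₁ α 1 - qs J₁ α x T - 2 * qs J₁ α x (A \ T)) := by
  have hTN' := Finset.disjoint_left.1 hTN
  by_cases hx : x ∈ A
  · simp only [hx, if_true, not_true, iff_false]
    have d1 : Disjoint (A \ T) T := Finset.sdiff_disjoint
    have d2 : Disjoint (A \ T ∪ T) (N.filter fun y => y ∉ A) := by
      rw [Finset.disjoint_left]; intro y; simp
      intro h hN; rcases h with h | h
      · exact h
      · exact absurd hN (hTN' h)
    have := qs_le J₁ α h1 hJ x ((A \ T ∪ T) ∪ (N.filter fun y => y ∉ A))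
    rw [qs_union _ _ _ d2, qs_union _ _ _ d1] at this
    linarith
  · simp only [hx, if_false, not_false_eq_true, iff_true]
    have : (N.filter fun y => y ∈ A) ⊆ A \ T := by
      intro y; simp; intro hN hA; exact ⟨hA, fun hT => hTN' hT hN⟩
    have := qs_mono J₁ α hJ x this
    linarith

lemma gain_lower0 (J₁ α : ℝ) (h1 : α < 1) (hJ : 0 ≤ J₁) (A T N D : Finset ℤ)
    (hTN : Disjoint T N) (η : Prop)
    (hT : ∀ x ∈ T, x ∉ D → (x ∈ A ↔ η)) (hN : ∀ y ∈ N, y ∉ D → (y ∈ A ↔ ¬ η)) :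
    ∑ x ∈ T, (qs J₁ α x T + 2 * qs J₁ α x N - 2 * tailJ J₁ α 1)
      - 2 * ∑ y ∈ N ∩ D, qs J₁ α y T - 2 * ∑ x ∈ T ∩ D, qs J₁ α x N ≤
    WW J₁ α A - WW J₁ α (symmDiff A T) := by
  rw [gain_formula]
  have key : ∀ x ∈ T, (qs J₁ α x T + 2 * qs J₁ α x N - 2 * tailJ J₁ α 1)
      - 2 * qs J₁ α x (N ∩ D) - 2 * (if x ∈ D then qs J₁ α x N else 0) ≤
      (if x ∈ A then (1 : ℝ) else -1) *
        (2 * tailJ J₁ α 1 - qs J₁ α x T - 2 * qs J₁ α x (A \ T)) := by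
    intro x hx
    refine le_trans ?_ (point_lower J₁ α h1 hJ A T N x hTN)
    have p1 := qs_nonneg J₁ α hJ x (N ∩ D)
    by_cases hD : x ∈ D
    · simp only [hD, if_true]
      have := qs_nonneg J₁ α hJ x (N.filter fun y => (y ∈ A ↔ ¬ x ∈ A))
      linarith
    · simp only [hD, if_false]
      have hsub : N \ D ⊆ N.filter fun y => (y ∈ A ↔ ¬ x ∈ A) := by
        intro y hy
        rw [Finset.mem_sdiff] at hy
        rw [Finset.mem_filter]
        refine ⟨hy.1, ?_⟩
        rw [hN y hy.1 hy.2, hT x hx hD]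
      have h2 := qs_mono J₁ α hJ x hsub
      have h3 : qs J₁ α x N = qs J₁ α x (N \ D) + qs J₁ α x (N ∩ D) := by
        rw [← qs_union _ _ _ (Finset.disjoint_sdiff_inter N D), Finset.sdiff_union_inter]
      linarith
  refine le_trans (le_of_eq ?_) (Finset.sum_le_sum key)
  rw [qs_comm J₁ α (N ∩ D) T]
  simp only [Finset.sum_sub_distrib, ← Finset.mul_sum, ← Finset.sum_filter,
    Finset.filter_mem_eq_inter]

lemma sum_Ico_shift (F : ℕ → ℝ) (a : ℤ) (L : ℕ) :
    ∑ x ∈ Finset.Ico a (a + L), F (x - a + 1).toNat = ∑ k ∈ Finset.Icc 1 L, F k := by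
  apply Finset.sum_nbij' (fun x => (x - a + 1).toNat) (fun k => a + k - 1)
  · intro x; simp; omega
  · intro x; simp; omega
  · intro x; simp; omega
  · intro x; simp; omega
  · intro x _; rfl

lemma sum_Ico_shift' (F : ℕ → ℝ) (a : ℤ) (L : ℕ) :
    ∑ x ∈ Finset.Ico a (a + L), F (a + L - x).toNat = ∑ k ∈ Finset.Icc 1 L, F k := by
  apply Finset.sum_nbij' (fun x => (a + L - x).toNat) (fun k => a + L - k)
  · intro x; simp; omega
  · intro x; simp; omega
  · intro x; simp; omega
  · intro x; simp
  · intro x _; rfl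

/-- gain from removing one triangle -/
lemma gain_triangle (J₁ α ζ ε : ℝ) (h0 : 0 < α) (h1 : α < 1)
    (hζ : ζ = 1 - 2 * ((2 : ℝ) ^ α - 1)) (hε0 : 0 ≤ ε) (hε : ε < 1) (hεζ : 12 * ε ≤ ζ)
    (hJ : 8 / (α * (1 - α)) ≤ J₁)
    (A D : Finset ℤ) (a : ℤ) (L : ℕ) (hL : 1 ≤ L) (η : Prop)
    (hT : ∀ x ∈ Finset.Ico a (a + L), x ∉ D → (x ∈ A ↔ η))
    (hN : ∀ y ∈ Finset.Ico (a - L) a ∪ Finset.Ico (a + L) (a + L + L), y ∉ D → (y ∈ A ↔ ¬ η))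
    (hd : ∀ e : ℤ, (e = a ∨ e = a + L) → ∀ d : ℕ, 1 ≤ d → d ≤ L →
      ((D ∩ Finset.Ico (e - d) (e + d)).card : ℝ) ≤ ε * d) :
    J₁ + ζ / (α * (1 - α)) * (L : ℝ) ^ α ≤
      WW J₁ α A - WW J₁ α (symmDiff A (Finset.Ico a (a + L))) := by
  have h1' : 0 < 1 - α := by linarith
  have h2 : 0 < α * (1 - α) := by positivity
  have hJ0 : 0 ≤ J₁ := le_trans (by positivity) hJ
  set T := Finset.Ico a (a + L) with hTdef
  set NL := Finset.Ico (a - L) a with hNL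
  set NR := Finset.Ico (a + L) (a + L + L) with hNR
  have dN : Disjoint NL NR := by
    rw [Finset.disjoint_left]; intro y; simp [NL, NR]; omega
  have dT : Disjoint T (NL ∪ NR) := by
    rw [Finset.disjoint_left]; intro y; simp [NL, NR, T]; omega
  have hg := gain_lower0 J₁ α h1 hJ0 A T (NL ∪ NR) D dT η hT hN
  have main : ∑ x ∈ T, (qs J₁ α x T + 2 * qs J₁ α x (NL ∪ NR) - 2 * tailJ J₁ α 1) =
      2 * ∑ k ∈ Finset.Icc 1 L, (tailJ J₁ α k - 2 * tailJ J₁ α (k + L)) := by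
    have e1 : ∀ x ∈ T, qs J₁ α x T + 2 * qs J₁ α x (NL ∪ NR) - 2 * tailJ J₁ α 1 =
        (tailJ J₁ α (x - a + 1).toNat - 2 * tailJ J₁ α ((x - a + 1).toNat + L)) +
        (tailJ J₁ α (a + L - x).toNat - 2 * tailJ J₁ α ((a + L - x).toNat + L)) := by
      intro x hx
      have hx' : a ≤ x ∧ x < a + L := by simpa [T] using hx
      have eT : T = Finset.Ico a (x + 1) ∪ Finset.Ico (x + 1) (a + L) := by
        ext y; simp [T]; omega
      have dT2 : Disjoint (Finset.Ico a (x + 1)) (Finset.Ico (x + 1) (a + L)) := by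
        rw [Finset.disjoint_left]; intro y; simp; omega
      rw [eT, qs_union _ _ _ dT2, qs_union _ _ _ dN,
        qs_left J₁ α h1 x a (x + 1) le_rfl (by omega),
        qs_right J₁ α h1 x (x + 1) (a + L) (by omega) (by omega),
        qs_left J₁ α h1 x (a - L) a (by omega) (by omega),
        qs_right J₁ α h1 x (a + L) (a + L + L) (by omega) (by omega)]
      have z0 : tz J₁ α (x - (x + 1) + 1) = tailJ J₁ α 1 := by
        rw [show x - (x + 1) + 1 = 0 by ring, tz_rec J₁ α h1 _ le_rfl, jz_zero _ _ h1]
        simp [tz]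
      have z1 : tz J₁ α (x + 1 - x) = tailJ J₁ α 1 := by
        rw [show x + 1 - x = 1 by ring]; rfl
      have z2 : tz J₁ α (x - (a - L) + 1) = tailJ J₁ α ((x - a + 1).toNat + L) := by
        unfold tz; congr 1; omega
      have z3 : tz J₁ α (a + L + L - x) = tailJ J₁ α ((a + L - x).toNat + L) := by
        unfold tz; congr 1; omega
      rw [z0, z1, z2, z3]
      unfold tz
      ring
    rw [Finset.sum_congr rfl e1, Finset.sum_add_distrib,
      sum_Ico_shift (fun k => tailJ J₁ α k - 2 * tailJ J₁ α (k + L)),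
      sum_Ico_shift' (fun k => tailJ J₁ α k - 2 * tailJ J₁ α (k + L))]
    ring
  have hA := harm_point J₁ α h0 h1 hJ0 ε hε0 hε D a L hL (hd a (Or.inl rfl))
  have hB := harm_point J₁ α h0 h1 hJ0 ε hε0 hε D (a + L) L hL (hd (a + L) (Or.inr rfl))
  have harm : ∑ y ∈ (NL ∪ NR) ∩ D, qs J₁ α y T + ∑ x ∈ T ∩ D, qs J₁ α x (NL ∪ NR) ≤
      ∑ z ∈ D ∩ Finset.Ico (a - L) (a + L), tailJ J₁ α (dpt a z) +
      ∑ z ∈ D ∩ Finset.Ico (a + L - L) (a + L + L), tailJ J₁ α (dpt (a + L) z) := by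
    have eA : D ∩ Finset.Ico (a - L) (a + L) = (NL ∩ D) ∪ (T ∩ D) := by
      ext y; simp [NL, T]; grind
    have eB : D ∩ Finset.Ico (a + L - L) (a + L + L) = (NR ∩ D) ∪ (T ∩ D) := by
      ext y; simp [NR, T]; grind
    have eC : (NL ∪ NR) ∩ D = (NL ∩ D) ∪ (NR ∩ D) := Finset.union_inter_distrib_right _ _ _
    have dA : Disjoint (NL ∩ D) (T ∩ D) := by
      rw [Finset.disjoint_left]; intro y; simp [NL, T]; grind
    have dB : Disjoint (NR ∩ D) (T ∩ D) := by
      rw [Finset.disjoint_left]; intro y; simp [NR, T]; grind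
    have dC : Disjoint (NL ∩ D) (NR ∩ D) := by
      rw [Finset.disjoint_left]; intro y; simp [NL, NR]; grind
    rw [eA, eB, eC, Finset.sum_union dA, Finset.sum_union dB, Finset.sum_union dC]
    have i1 : ∑ y ∈ NL ∩ D, qs J₁ α y T ≤ ∑ z ∈ NL ∩ D, tailJ J₁ α (dpt a z) := by
      apply Finset.sum_le_sum
      intro y hy
      have hy' : a - L ≤ y ∧ y < a := by simpa [NL] using (Finset.mem_inter.1 hy).1
      rw [qs_right J₁ α h1 y a (a + L) (by omega) (by omega)]
      have := tz_nonneg J₁ α hJ0 (a + L - y)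
      have e : tz J₁ α (a - y) = tailJ J₁ α (dpt a y) := by
        unfold tz dpt; rw [if_neg (by omega)]
      linarith
    have i2 : ∑ y ∈ NR ∩ D, qs J₁ α y T ≤ ∑ z ∈ NR ∩ D, tailJ J₁ α (dpt (a + L) z) := by
      apply Finset.sum_le_sum
      intro y hy
      have hy' : a + L ≤ y ∧ y < a + L + L := by simpa [NR] using (Finset.mem_inter.1 hy).1
      rw [qs_left J₁ α h1 y a (a + L) (by omega) (by omega)]
      have := tz_nonneg J₁ α hJ0 (y - a + 1)
      have e : tz J₁ α (y - (a + L) + 1) = tailJ J₁ α (dpt (a + L) y) := by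
        unfold tz dpt; rw [if_pos (by omega)]
      linarith
    have i3 : ∑ x ∈ T ∩ D, qs J₁ α x (NL ∪ NR) ≤ ∑ z ∈ T ∩ D, tailJ J₁ α (dpt a z) +
        ∑ z ∈ T ∩ D, tailJ J₁ α (dpt (a + L) z) := by
      rw [← Finset.sum_add_distrib]
      apply Finset.sum_le_sum
      intro x hx
      have hx' : a ≤ x ∧ x < a + L := by simpa [T] using (Finset.mem_inter.1 hx).1
      rw [qs_union _ _ _ dN, qs_left J₁ α h1 x (a - L) a (by omega) (by omega),
        qs_right J₁ α h1 x (a + L) (a + L + L) (by omega) (by omega)]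
      have := tz_nonneg J₁ α hJ0 (x - (a - L) + 1)
      have := tz_nonneg J₁ α hJ0 (a + L + L - x)
      have e : tz J₁ α (x - a + 1) = tailJ J₁ α (dpt a x) := by
        unfold tz dpt; rw [if_pos (by omega)]
      have e' : tz J₁ α (a + L - x) = tailJ J₁ α (dpt (a + L) x) := by
        unfold tz dpt; rw [if_neg (by omega)]
      linarith
    linarith
  have hm := tail_main J₁ α ζ h0 h1 hJ0 hζ L hL
  rw [main] at hg
  have hLp : 0 ≤ (L : ℝ) ^ α := by positivity
  have fin : J₁ + ζ / (α * (1 - α)) * (L : ℝ) ^ α ≤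
      2 * (J₁ + (ζ * (L : ℝ) ^ α - 4) / (α * (1 - α))) -
      2 * (2 * (ε * (3 * (L : ℝ) ^ α / (α * (1 - α))))) := by
    have e : 2 * (J₁ + (ζ * (L : ℝ) ^ α - 4) / (α * (1 - α))) -
      2 * (2 * (ε * (3 * (L : ℝ) ^ α / (α * (1 - α))))) =
      J₁ + ζ / (α * (1 - α)) * (L : ℝ) ^ α + (J₁ - 8 / (α * (1 - α))) +
        (ζ - 12 * ε) * ((L : ℝ) ^ α / (α * (1 - α))) := by ring
    rw [e]
    have : 0 ≤ (ζ - 12 * ε) * ((L : ℝ) ^ α / (α * (1 - α))) :=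
      mul_nonneg (by linarith) (by positivity)
    linarith
  linarith


/-- size of a triangle -/
def sz (T : ℤ × ℤ) : ℕ := (T.2 - T.1).toNat

/-- endpoints of a family of triangles -/
def ends (Γ : Finset (ℤ × ℤ)) : Finset ℤ := Γ.image Prod.fst ∪ Γ.image Prod.snd

lemma mem_ends (Γ : Finset (ℤ × ℤ)) (x : ℤ) :
    x ∈ ends Γ ↔ ∃ T ∈ Γ, x = T.1 ∨ x = T.2 := by
  unfold ends
  simp only [Finset.mem_union, Finset.mem_image]
  constructor
  · rintro (⟨T, h, rfl⟩ | ⟨T, h, rfl⟩)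
    · exact ⟨T, h, Or.inl rfl⟩
    · exact ⟨T, h, Or.inr rfl⟩
  · rintro ⟨T, h, rfl | rfl⟩
    · exact Or.inl ⟨T, h, rfl⟩
    · exact Or.inr ⟨T, h, rfl⟩

/-- admissible family of triangles -/
def Tri (𝒯 : Finset (ℤ × ℤ)) : Prop :=
  (∀ T ∈ 𝒯, T.1 < T.2) ∧ ∀ T ∈ 𝒯, ∀ S ∈ 𝒯, T ≠ S → ∀ e e' : ℤ,
    (e = T.1 ∨ e = T.2) → (e' = S.1 ∨ e' = S.2) → ((min (sz T) (sz S) : ℕ) : ℤ) ≤ |e - e'|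

lemma Tri.mono {𝒯 Γ : Finset (ℤ × ℤ)} (h : Tri 𝒯) (hs : Γ ⊆ 𝒯) : Tri Γ :=
  ⟨fun T hT => h.1 T (hs hT), fun T hT S hS => h.2 T (hs hT) S (hs hS)⟩

lemma exists_tri : ∀ (n : ℕ) (P : Finset ℤ), P.card = 2 * n →
    ∃ 𝒯, Tri 𝒯 ∧ ends 𝒯 = P := by
  intro n
  induction n with
  | zero =>
    intro P hP
    have : P = ∅ := by simpa using hP
    subst this
    exact ⟨∅, ⟨by simp, by simp⟩, by simp [ends]⟩
  | succ n ih =>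
    intro P hP
    have hne : (P.offDiag.filter fun q => q.1 < q.2).Nonempty := by
      obtain ⟨x, hx, y, hy, hxy⟩ := Finset.one_lt_card.1 (show 1 < P.card by omega)
      rcases lt_or_gt_of_ne hxy with h | h
      · exact ⟨(x, y), by simp [hx, hy, h, hxy]⟩
      · exact ⟨(y, x), by simp [hx, hy, h, hxy.symm]⟩
    obtain ⟨⟨a, b⟩, hab, hmin⟩ := Finset.exists_min_image _ (fun q : ℤ × ℤ => q.2 - q.1) hne
    simp only [Finset.mem_filter, Finset.mem_offDiag] at hab hmin
    obtain ⟨⟨ha, hb, hne'⟩, hlt⟩ := hab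
    have hmin' : ∀ x ∈ P, ∀ y ∈ P, x ≠ y → b - a ≤ |x - y| := by
      intro x hx y hy hxy
      rcases lt_or_gt_of_ne hxy with h | h
      · have := hmin (x, y) ⟨⟨hx, hy, hxy⟩, h⟩
        simp only at this
        rw [abs_of_neg (by omega)]; omega
      · have := hmin (y, x) ⟨⟨hy, hx, hxy.symm⟩, h⟩
        simp only at this
        rw [abs_of_pos (by omega)]; omega
    obtain ⟨𝒯, hT, hE⟩ := ih ((P.erase a).erase b) (by
      rw [Finset.card_erase_of_mem, Finset.card_erase_of_mem ha, hP]
      · omega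
      · simp [hb]; omega)
    have hend : ∀ S ∈ 𝒯, ∀ e, (e = S.1 ∨ e = S.2) → e ∈ P ∧ e ≠ a ∧ e ≠ b := by
      intro S hS e he
      have : e ∈ ends 𝒯 := (mem_ends _ _).2 ⟨S, hS, he⟩
      rw [hE] at this
      simp at this
      tauto
    have hclose : ∀ S ∈ 𝒯, ∀ e e' : ℤ, (e = a ∨ e = b) → (e' = S.1 ∨ e' = S.2) →
        b - a ≤ |e - e'| := by
      intro S hS e e' he he'
      obtain ⟨h1, h2, h3⟩ := hend S hS e' he'
      apply hmin' _ _ _ h1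
      · rcases he with rfl | rfl
        · exact fun h => h2 h.symm
        · exact fun h => h3 h.symm
      · rcases he with rfl | rfl <;> assumption
    refine ⟨insert (a, b) 𝒯, ⟨?_, ?_⟩, ?_⟩
    · intro T hTm
      rcases Finset.mem_insert.1 hTm with rfl | h
      · exact hlt
      · exact hT.1 T h
    · intro T hTm S hSm hTS e e' he he'
      rcases Finset.mem_insert.1 hTm with rfl | h
      · rcases Finset.mem_insert.1 hSm with rfl | h'
        · exact absurd rfl hTS
        · have := hclose S h' e e' he he'
          have e1 : sz (a, b) = (b - a).toNat := rfl
          omega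
      · rcases Finset.mem_insert.1 hSm with rfl | h'
        · have := hclose T h e' e he' he
          have e1 : sz (a, b) = (b - a).toNat := rfl
          rw [abs_sub_comm]
          omega
        · exact hT.2 T h S h' hTS e e' he he'
    · ext x
      rw [mem_ends]
      constructor
      · rintro ⟨T, hTm, hx⟩
        rcases Finset.mem_insert.1 hTm with rfl | h
        · rcases hx with rfl | rfl <;> assumption
        · exact (hend T h x hx).1
      · intro hx
        by_cases h1 : x = a
        · exact ⟨(a, b), by simp, Or.inl h1⟩
        by_cases h2 : x = b
        · exact ⟨(a, b), by simp, Or.inr h2⟩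
        have : x ∈ ends 𝒯 := by rw [hE]; simp [h1, h2, hx]
        obtain ⟨T, h, hend2⟩ := (mem_ends _ _).1 this
        exact ⟨T, by simp [h], hend2⟩

/-- boundary points of a finite set -/
def bdry (A : Finset ℤ) : Finset ℤ :=
  (A ∪ A.image (· + 1)).filter fun x => ¬ (x ∈ A ↔ x - 1 ∈ A)

lemma mem_bdry (A : Finset ℤ) (x : ℤ) : x ∈ bdry A ↔ ¬ (x ∈ A ↔ x - 1 ∈ A) := by
  unfold bdry
  simp only [Finset.mem_filter, Finset.mem_union, Finset.mem_image, and_iff_right_iff_imp]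
  intro h
  by_cases hx : x ∈ A
  · exact Or.inl hx
  · right
    refine ⟨x - 1, ?_, by ring⟩
    by_contra h2
    exact h (by simp [hx, h2])

lemma exists_bound (A : Finset ℤ) : ∃ m : ℤ, ∀ x ∈ A, |x| < m := by
  refine ⟨∑ y ∈ A, |y| + 1, fun y hy => ?_⟩
  have := Finset.single_le_sum (f := fun y => |y|) (fun _ _ => abs_nonneg _) hy
  omega

lemma odd_bdry (A : Finset ℤ) (x : ℤ) :
    x ∈ A ↔ Odd ((bdry A).filter fun p => p ≤ x).card := by
  obtain ⟨m, hm⟩ := exists_bound (A ∪ bdry A)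
  have hlow : ∀ y ≤ -m, y ∉ A ∪ bdry A := by
    intro y hy h; have := abs_lt.1 (hm y h); omega
  have base : ∀ y ≤ -m, (y ∈ A ↔ Odd ((bdry A).filter fun p => p ≤ y).card) := by
    intro y hy
    have : (bdry A).filter (fun p => p ≤ y) = ∅ := by
      rw [Finset.filter_eq_empty_iff]
      intro p hp hpy
      exact hlow p (by omega) (Finset.mem_union_right _ hp)
    rw [this]
    simp
    exact fun h => hlow y hy (Finset.mem_union_left _ h)
  rcases le_total x (-m) with h | h
  · exact base x h
  · induction x, h using Int.leInduction with
    | base => exact base _ le_rfl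
    | succ x hx ih0 =>
      have ih : x ∈ A ↔ Odd ((bdry A).filter fun p => p ≤ x).card := ih0
      by_cases hb : x + 1 ∈ bdry A
      · have e : (bdry A).filter (fun p => p ≤ x + 1) =
            insert (x + 1) ((bdry A).filter fun p => p ≤ x) := by
          ext p; simp only [Finset.mem_filter, Finset.mem_insert]
          constructor
          · rintro ⟨h1, h2⟩
            by_cases h3 : p = x + 1
            · exact Or.inl h3
            · exact Or.inr ⟨h1, by omega⟩
          · rintro (rfl | ⟨h1, h2⟩)
            · exact ⟨hb, le_rfl⟩
            · exact ⟨h1, by omega⟩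
        rw [e, Finset.card_insert_of_notMem (by simp), Nat.odd_add_one, ← ih]
        have := (mem_bdry A _).1 hb
        rw [show x + 1 - 1 = x by ring] at this
        tauto
      · have e : (bdry A).filter (fun p => p ≤ x + 1) = ((bdry A).filter fun p => p ≤ x) := by
          ext p; simp only [Finset.mem_filter]
          constructor
          · rintro ⟨h1, h2⟩
            by_cases h3 : p = x + 1
            · exact absurd (h3 ▸ h1) hb
            · exact ⟨h1, by omega⟩
          · rintro ⟨h1, h2⟩
            exact ⟨h1, by omega⟩
        rw [e, ← ih]
        have := (mem_bdry A (x + 1)).not.1 hb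
        rw [show x + 1 - 1 = x by ring] at this
        tauto

lemma even_bdry (A : Finset ℤ) : ∃ n, (bdry A).card = 2 * n := by
  obtain ⟨m, hm⟩ := exists_bound (A ∪ bdry A)
  have h := odd_bdry A m
  have e : (bdry A).filter (fun p => p ≤ m) = bdry A := by
    rw [Finset.filter_eq_self]
    intro p hp
    have := abs_lt.1 (hm p (Finset.mem_union_right _ hp)); omega
  rw [e] at h
  have h2 : m ∉ A := by
    intro hA
    have := abs_lt.1 (hm m (Finset.mem_union_left _ hA)); omega
  have h3 : ¬ Odd (bdry A).card := fun h' => h2 (h.2 h')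
  rw [Nat.not_odd_iff_even] at h3
  obtain ⟨n, hn⟩ := h3
  exact ⟨n, by omega⟩

/-- sites covered an odd number of times -/
def par (Γ : Finset (ℤ × ℤ)) : Finset ℤ :=
  (Γ.biUnion fun T => Finset.Ico T.1 T.2).filter fun x =>
    Odd (Γ.filter fun T => x ∈ Finset.Ico T.1 T.2).card

lemma mem_par (Γ : Finset (ℤ × ℤ)) (x : ℤ) :
    x ∈ par Γ ↔ Odd (Γ.filter fun T => x ∈ Finset.Ico T.1 T.2).card := by
  unfold par
  rw [Finset.mem_filter, and_iff_right_iff_imp]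
  intro h
  obtain ⟨T, hT⟩ := Finset.card_pos.1 h.pos
  rw [Finset.mem_filter] at hT
  exact Finset.mem_biUnion.2 ⟨T, hT.1, hT.2⟩

lemma par_union {Γ Δ : Finset (ℤ × ℤ)} (h : Disjoint Γ Δ) :
    par (Γ ∪ Δ) = symmDiff (par Γ) (par Δ) := by
  ext x
  rw [Finset.mem_symmDiff, mem_par, mem_par, mem_par, Finset.filter_union,
    Finset.card_union_of_disjoint (Finset.disjoint_filter_filter h), Nat.odd_add]
  rw [← Nat.not_odd_iff_even]
  tauto

lemma par_singleton (T : ℤ × ℤ) : par {T} = Finset.Ico T.1 T.2 := by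
  ext x
  rw [mem_par, Finset.filter_singleton]
  split_ifs with h
  · simp only [h, Finset.card_singleton]; simp
  · simp only [h]; simp

lemma par_sdiff {Γ Δ : Finset (ℤ × ℤ)} (h : Δ ⊆ Γ) :
    par (Γ \ Δ) = symmDiff (par Γ) (par Δ) := by
  have : par Γ = symmDiff (par (Γ \ Δ)) (par Δ) := by
    rw [← par_union Finset.sdiff_disjoint, Finset.sdiff_union_of_subset h]
  rw [this, symmDiff_symmDiff_cancel_right]

lemma par_card_le (Γ : Finset (ℤ × ℤ)) : (par Γ).card ≤ ∑ T ∈ Γ, sz T := by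
  refine (Finset.card_le_card (Finset.filter_subset _ _)).trans ?_
  refine Finset.card_biUnion_le.trans ?_
  apply Finset.sum_le_sum
  intro T _
  simp [sz]

lemma par_ends (Γ : Finset (ℤ × ℤ)) (h : Tri Γ) (x : ℤ) :
    x ∈ par Γ ↔ Odd ((ends Γ).filter fun p => p ≤ x).card := by
  induction Γ using Finset.induction_on with
  | empty => simp [mem_par, ends]
  | insert T Γ hT ih =>
    have ih := ih (h.mono (Finset.subset_insert _ _))
    have hlt := h.1 T (Finset.mem_insert_self _ _)
    have e1 : par (insert T Γ) = symmDiff (par Γ) (Finset.Ico T.1 T.2) := by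
      rw [← par_singleton, ← par_union (by simpa using hT), Finset.union_comm]; rfl
    have hdist : ∀ e, (e = T.1 ∨ e = T.2) → e ∉ ends Γ := by
      intro e he hm
      obtain ⟨S, hS, he'⟩ := (mem_ends _ _).1 hm
      have hne : T ≠ S := by rintro rfl; exact hT hS
      have := h.2 T (Finset.mem_insert_self _ _) S (Finset.mem_insert_of_mem hS) hne e e he he'
      have hltS := h.1 S (Finset.mem_insert_of_mem hS)
      simp [sz] at this
      omega
    have e2 : ends (insert T Γ) = insert T.1 (insert T.2 (ends Γ)) := by
      ext y
      simp only [mem_ends, Finset.mem_insert]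
      constructor
      · rintro ⟨S, rfl | hS, hy⟩
        · tauto
        · exact Or.inr (Or.inr ⟨S, hS, hy⟩)
      · rintro (rfl | rfl | ⟨S, hS, hy⟩)
        · exact ⟨T, by simp⟩
        · exact ⟨T, by simp⟩
        · exact ⟨S, Or.inr hS, hy⟩
    have n1 : T.1 ∉ insert T.2 (ends Γ) := by
      rw [Finset.mem_insert]; rintro (h1 | h1)
      · omega
      · exact hdist _ (Or.inl rfl) h1
    have n2 := hdist _ (Or.inr rfl)
    rw [e1, e2, Finset.mem_symmDiff, ih, Finset.filter_insert, Finset.filter_insert,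
      Finset.mem_Ico]
    have n2' : T.2 ∉ (ends Γ).filter fun p => p ≤ x := by simp [n2]
    have n3 : T.1 ∉ (ends Γ).filter fun p => p ≤ x := by
      simp only [Finset.mem_filter]; intro hh; exact hdist _ (Or.inl rfl) hh.1
    by_cases c1 : T.1 ≤ x <;> by_cases c2 : T.2 ≤ x
    · rw [if_pos c1, if_pos c2, Finset.card_insert_of_notMem, Finset.card_insert_of_notMem n2']
      · rw [Nat.odd_add_one, Nat.odd_add_one]
        have : ¬ (x < T.2) := by omega
        tauto
      · rw [Finset.mem_insert]; push Not; exact ⟨by omega, n3⟩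
    · rw [if_pos c1, if_neg c2, Finset.card_insert_of_notMem n3, Nat.odd_add_one]
      have : x < T.2 := by omega
      tauto
    · omega
    · rw [if_neg c1, if_neg c2]
      tauto

lemma exists_triangles (A : Finset ℤ) : ∃ 𝒯, Tri 𝒯 ∧ ends 𝒯 = bdry A ∧ par 𝒯 = A := by
  obtain ⟨n, hn⟩ := even_bdry A
  obtain ⟨𝒯, hT, hE⟩ := exists_tri n _ hn
  refine ⟨𝒯, hT, hE, ?_⟩
  ext x
  rw [par_ends 𝒯 hT, hE, ← odd_bdry]


/-- positions visited by a walk -/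
def vis : ℤ → List ℤ → List ℤ
  | _, [] => []
  | x, s :: l => (x + s) :: vis (x + s) l

/-- cost of a step -/
def stepc (s : ℤ) : ℝ := 1 + Real.log (1 + |(s : ℝ)|)

/-- cost of a walk -/
def wcost (l : List ℤ) : ℝ := (l.map stepc).sum

lemma stepc_ge (s : ℤ) : 1 ≤ stepc s := by
  unfold stepc
  have : 0 ≤ Real.log (1 + |(s : ℝ)|) := Real.log_nonneg (by linarith [abs_nonneg (s : ℝ)])
  linarith

lemma stepc_neg (s : ℤ) : stepc (-s) = stepc s := by simp [stepc]

lemma walk_insert (p z : ℤ) : ∀ (l : List ℤ) (x : ℤ), p ∈ vis x l →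
    ∃ l', (∀ y ∈ vis x l, y ∈ vis x l') ∧ z ∈ vis x l' ∧
      wcost l' = wcost l + 2 * stepc (z - p) := by
  intro l
  induction l with
  | nil => intro x h; simp [vis] at h
  | cons s l ih =>
    intro x h
    simp only [vis, List.mem_cons] at h
    rcases h with h | h
    · refine ⟨s :: (z - p) :: (p - z) :: l, ?_, ?_, ?_⟩
      · intro y hy
        simp only [vis, List.mem_cons] at hy ⊢
        rw [show x + s + (z - p) + (p - z) = x + s by ring]
        tauto
      · simp only [vis, List.mem_cons]
        right; left; rw [← h]; ring
      · simp only [wcost, List.map_cons, List.sum_cons]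
        rw [← stepc_neg (p - z), show -(p - z) = z - p by ring]
        ring
    · obtain ⟨l', h1, h2, h3⟩ := ih (x + s) h
      refine ⟨s :: l', ?_, ?_, ?_⟩
      · intro y hy
        simp only [vis, List.mem_cons] at hy ⊢
        rcases hy with hy | hy
        · exact Or.inl hy
        · exact Or.inr (h1 y hy)
      · simp only [vis, List.mem_cons]; exact Or.inr h2
      · simp only [wcost, List.map_cons, List.sum_cons] at *
        rw [h3]; ring

/-- all points of `P` can be visited at cost at most `c` -/
def Reach (P : Finset ℤ) (c : ℝ) : Prop :=
  ∃ l : List ℤ, (∀ p ∈ P, p ∈ vis 0 l) ∧ wcost l ≤ c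

lemma Reach.mono {P : Finset ℤ} {c c' : ℝ} (h : Reach P c) (hc : c ≤ c') : Reach P c' := by
  obtain ⟨l, h1, h2⟩ := h
  exact ⟨l, h1, h2.trans hc⟩

lemma Reach.insert {P : Finset ℤ} {c : ℝ} (h : Reach P c) (p z : ℤ) (hp : p ∈ P) :
    Reach (insert z P) (c + 2 * stepc (z - p)) := by
  obtain ⟨l, h1, h2⟩ := h
  obtain ⟨l', h3, h4, h5⟩ := walk_insert p z l 0 (h1 p hp)
  refine ⟨l', ?_, by linarith⟩
  intro y hy
  rcases Finset.mem_insert.1 hy with rfl | hy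
  · exact h4
  · exact h3 y (h1 y hy)

lemma stepc_le (s : ℤ) (lam : ℝ) (hl : 1 ≤ lam) :
    stepc s ≤ 1 + Real.log lam + |(s : ℝ)| / lam := by
  unfold stepc
  have hpos : 0 < 1 + |(s : ℝ)| := by linarith [abs_nonneg (s : ℝ)]
  have hl0 : 0 < lam := by linarith
  have h1 : Real.log ((1 + |(s : ℝ)|) / lam) ≤ (1 + |(s : ℝ)|) / lam - 1 :=
    Real.log_le_sub_one_of_pos (by positivity)
  rw [Real.log_div hpos.ne' hl0.ne'] at h1
  have h2 : 1 / lam ≤ 1 := by rw [div_le_one hl0]; exact hl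
  rw [add_div] at h1
  linarith

lemma Reach.side {P : Finset ℤ} {c : ℝ} (h : Reach P c) (e : ℤ) (he : e ∈ P)
    (lam : ℝ) (hl : 1 ≤ lam) (Q : Finset ℤ)
    (hQ : (∀ q ∈ Q, e < q) ∨ (∀ q ∈ Q, q < e)) (D : ℝ) (hD0 : 0 ≤ D)
    (hD : ∀ q ∈ Q, |((q : ℝ) - e)| ≤ D) :
    Reach (P ∪ Q) (c + Q.card * (2 * Real.log lam + 2) + 2 / lam * D) := by
  have hl0 : 0 < lam := by linarith
  have key : ∃ r ∈ P ∪ Q, (r = e ∨ r ∈ Q) ∧ (∀ q ∈ Q, |q - e| ≤ |r - e|) ∧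
      Reach (P ∪ Q) (c + Q.card * (2 * Real.log lam + 2) + 2 / lam * |((r : ℝ) - e)|) := by
    clear hD
    induction Q using Finset.induction_on_max_value (fun q => |q - e|) with
    | empty => exact ⟨e, by simpa using he, Or.inl rfl, by simp, by simpa using h⟩
    | insert q Q hq hmax ih =>
      obtain ⟨r, hr, hrQ, hrmax, hR⟩ := ih (by
        rcases hQ with hQ | hQ
        · left; intro x hx; exact hQ x (Finset.mem_insert_of_mem hx)
        · right; intro x hx; exact hQ x (Finset.mem_insert_of_mem hx))
      have hrq : |r - e| ≤ |q - e| := by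
        rcases hrQ with rfl | hrQ
        · simp
        · exact hmax r hrQ
      refine ⟨q, by simp, Or.inr (by simp), ?_, ?_⟩
      · intro x hx
        rcases Finset.mem_insert.1 hx with rfl | hx
        · exact le_rfl
        · exact hmax x hx
      · rw [Finset.union_insert]
        refine (hR.insert r q hr).mono ?_
        have hd : |q - r| = |q - e| - |r - e| := by
          rcases hQ with hQ | hQ
          · have a1 : e < q := hQ q (by simp)
            have a2 : e ≤ r := by
              rcases hrQ with rfl | hrQ
              · exact le_rfl
              · exact (hQ r (by simp [hrQ])).le
            rw [abs_of_pos (show 0 < q - e by omega), abs_of_nonneg (show 0 ≤ r - e by omega)] at *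
            rw [abs_of_nonneg (by omega)]; ring
          · have a1 : q < e := hQ q (by simp)
            have a2 : r ≤ e := by
              rcases hrQ with rfl | hrQ
              · exact le_rfl
              · exact (hQ r (by simp [hrQ])).le
            rw [abs_of_neg (show q - e < 0 by omega), abs_of_nonpos (show r - e ≤ 0 by omega)] at *
            rw [abs_of_nonpos (by omega)]; ring
        have hd' : |((q - r : ℤ) : ℝ)| = |(q : ℝ) - e| - |(r : ℝ) - e| := by
          rw [← Int.cast_abs, hd]; push_cast; rfl
        have h1 := stepc_le (q - r) lam hl
        rw [hd'] at h1
        rw [Finset.card_insert_of_notMem hq]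
        push_cast
        have e3 : 2 / lam * |(q : ℝ) - e| - 2 / lam * |(r : ℝ) - e| =
          2 * ((|(q : ℝ) - e| - |(r : ℝ) - e|) / lam) := by ring
        linarith
  obtain ⟨r, hr, hrQ, _, hR⟩ := key
  refine hR.mono ?_
  have : |(r : ℝ) - e| ≤ D := by
    rcases hrQ with rfl | hrQ
    · simpa using hD0
    · exact hD r hrQ
  gcongr

lemma Reach.both {P : Finset ℤ} {c : ℝ} (h : Reach P c) (e : ℤ) (he : e ∈ P)
    (lam : ℝ) (hl : 1 ≤ lam) (Q : Finset ℤ) (D : ℝ) (hD0 : 0 ≤ D)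
    (hD : ∀ q ∈ Q, |((q : ℝ) - e)| ≤ D) :
    Reach (P ∪ Q) (c + Q.card * (2 * Real.log lam + 2) + 4 / lam * D) := by
  have hlog : 0 ≤ Real.log lam := Real.log_nonneg hl
  have h1 := h.side e he lam hl (Q.filter fun q => e < q) (Or.inl (by simp)) D hD0
    (fun q hq => hD q (Finset.mem_filter.1 hq).1)
  have h2 := h1.side e (by simp [he]) lam hl (Q.filter fun q => q < e) (Or.inr (by simp)) D hD0
    (fun q hq => hD q (Finset.mem_filter.1 hq).1)
  have hsub : P ∪ Q ⊆ P ∪ (Q.filter fun q => e < q) ∪ (Q.filter fun q => q < e) := by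
    intro x hx
    simp only [Finset.mem_union, Finset.mem_filter] at *
    rcases hx with hx | hx
    · tauto
    · rcases lt_trichotomy x e with h | h | h
      · tauto
      · subst h; tauto
      · tauto
  obtain ⟨l, h3, h4⟩ := h2
  refine ⟨l, fun p hp => h3 p (hsub hp), h4.trans ?_⟩
  have hc : (Q.filter fun q => e < q).card + (Q.filter fun q => q < e).card ≤ Q.card := by
    rw [← Finset.card_union_of_disjoint]
    · apply Finset.card_le_card
      intro x; simp; tauto
    · rw [Finset.disjoint_left]; intro x; simp; intro _ h _; omega
  have hc' : ((Q.filter fun q => e < q).card : ℝ) + ((Q.filter fun q => q < e).card : ℝ) ≤ Q.card := by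
    exact_mod_cast hc
  have : (((Q.filter fun q => e < q).card : ℝ) + ((Q.filter fun q => q < e).card : ℝ)) *
      (2 * Real.log lam + 2) ≤ Q.card * (2 * Real.log lam + 2) := by gcongr
  have e4 : 4 / lam * D = 2 / lam * D + 2 / lam * D := by ring
  linarith


lemma exists_kappa (s ε : ℝ) (hs : 0 < s) (hε : 0 < ε) : ∃ κ : ℝ, 32 ≤ κ ∧ 4 + 2 / s ≤ κ ∧
    ∀ l : ℕ, 1 ≤ l → Real.exp (-(κ * (l : ℝ) ^ s / 8)) ≤ ε / (2 * (l : ℝ) ^ 3) := by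
  obtain ⟨k, hk⟩ := exists_nat_gt (3 / s)
  have hk0 : 0 < k := by
    rcases Nat.eq_zero_or_pos k with h | h
    · subst h; have : 0 < 3 / s := by positivity
      norm_num at hk; linarith
    · exact h
  refine ⟨max (max 32 (4 + 2 / s)) ((k.factorial : ℝ) * 8 ^ k * 2 / ε), ?_, ?_, ?_⟩
  · exact (le_max_left _ _).trans (le_max_left _ _)
  · exact (le_max_right _ _).trans (le_max_left _ _)
  · intro l hl
    set κ := max (max 32 (4 + 2 / s)) ((k.factorial : ℝ) * 8 ^ k * 2 / ε) with hκ
    have h32 : 32 ≤ κ := (le_max_left _ _).trans (le_max_left _ _)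
    have hbig : (k.factorial : ℝ) * 8 ^ k * 2 / ε ≤ κ := le_max_right _ _
    have hl1 : (1 : ℝ) ≤ l := by exact_mod_cast hl
    have hl0 : (0 : ℝ) < l := by linarith
    have hy : 0 ≤ κ * (l : ℝ) ^ s / 8 := by positivity
    have h1 := Real.pow_div_factorial_le_exp (κ * (l : ℝ) ^ s / 8) hy k
    have hp : (l : ℝ) ^ 3 ≤ ((l : ℝ) ^ s) ^ k := by
      rw [← Real.rpow_natCast, ← Real.rpow_natCast, ← Real.rpow_mul hl0.le]
      apply Real.rpow_le_rpow_of_exponent_le hl1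
      rw [div_lt_iff₀ hs] at hk
      push_cast; linarith
    have hκk : κ ≤ κ ^ k := le_self_pow₀ (by linarith) hk0.ne'
    rw [Real.exp_neg, inv_le_comm₀ (Real.exp_pos _) (by positivity), inv_div]
    refine le_trans ?_ h1
    rw [div_le_div_iff₀ hε (by positivity), div_pow, mul_pow]
    rw [div_le_iff₀ hε] at hbig
    have hA : 0 ≤ (l : ℝ) ^ 3 := by positivity
    have h8 : (0 : ℝ) < 8 ^ k := by positivity
    rw [div_mul_eq_mul_div, le_div_iff₀ h8]
    calc 2 * (l : ℝ) ^ 3 * k.factorial * 8 ^ k = (k.factorial * 8 ^ k * 2) * (l : ℝ) ^ 3 := by ring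
      _ ≤ (κ * ε) * (l : ℝ) ^ 3 := by gcongr
      _ ≤ (κ ^ k * ε) * ((l : ℝ) ^ s) ^ k := by gcongr
      _ = _ := by ring

/-- mass of a family -/
def msum (s : ℝ) (Γ : Finset (ℤ × ℤ)) : ℝ := ∑ T ∈ Γ, (sz T : ℝ) ^ s

/-- cheap families containing `T₀` -/
def Good (κ s : ℝ) (T₀ : ℤ × ℤ) (𝒯 Γ : Finset (ℤ × ℤ)) : Prop :=
  Γ ⊆ 𝒯 ∧ T₀ ∈ Γ ∧ Reach (ends Γ) (κ * msum s Γ)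

/-- maximal cheap family -/
def MaxGood (κ s : ℝ) (T₀ : ℤ × ℤ) (𝒯 Γ : Finset (ℤ × ℤ)) : Prop :=
  Good κ s T₀ 𝒯 Γ ∧ ∀ Γ', Good κ s T₀ 𝒯 Γ' → Γ'.card ≤ Γ.card

lemma ends_singleton (T : ℤ × ℤ) : ends {T} = {T.1, T.2} := by
  ext x; simp [mem_ends]

lemma log_bound (s : ℝ) (hs : 0 < s) (L : ℕ) (hL : 1 ≤ L) :
    Real.log (1 + L) ≤ (1 + 1 / s) * (L : ℝ) ^ s := by
  have hl1 : (1 : ℝ) ≤ L := by exact_mod_cast hL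
  have hp : 1 ≤ (L : ℝ) ^ s := Real.one_le_rpow hl1 hs.le
  have h1 : Real.log (1 + L) ≤ Real.log (2 * L) := Real.log_le_log (by linarith) (by linarith)
  rw [Real.log_mul (by norm_num) (by linarith)] at h1
  have h2 : Real.log 2 ≤ 1 := by
    have := Real.log_le_sub_one_of_pos (show (0 : ℝ) < 2 by norm_num); linarith
  have h3 : Real.log L ≤ (L : ℝ) ^ s / s := Real.log_le_rpow_div (by linarith) hs
  have : (1 + 1 / s) * (L : ℝ) ^ s = (L : ℝ) ^ s + (L : ℝ) ^ s / s := by ring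
  linarith

lemma exists_maxGood (κ s : ℝ) (hs : 0 < s) (hκ : 4 + 2 / s ≤ κ) (T₀ : ℤ × ℤ)
    (𝒯 : Finset (ℤ × ℤ)) (hT : T₀ ∈ 𝒯) (h1 : T₀.1 ≤ 0) (h2 : 0 < T₀.2) :
    ∃ Γ, MaxGood κ s T₀ 𝒯 Γ := by
  have hg : Good κ s T₀ 𝒯 {T₀} := by
    refine ⟨by simpa using hT, by simp, ?_⟩
    refine ⟨[T₀.1, T₀.2 - T₀.1], ?_, ?_⟩
    · intro p hp
      rw [ends_singleton] at hp
      simp at hp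
      simp [vis]; exact hp
    · simp only [wcost, msum, List.map_cons, List.map_nil, List.sum_cons, List.sum_nil,
        Finset.sum_singleton]
      set L := sz T₀ with hL
      have hL1 : 1 ≤ L := by simp [hL, sz]; omega
      have hLr : ((L : ℕ) : ℤ) = T₀.2 - T₀.1 := by simp [hL, sz]; omega
      have hLr' : (L : ℝ) = ((T₀.2 - T₀.1 : ℤ) : ℝ) := by exact_mod_cast hLr
      have hlog := log_bound s hs L hL1
      have e1 : stepc (T₀.2 - T₀.1) = 1 + Real.log (1 + L) := by
        unfold stepc; rw [← hLr', abs_of_nonneg (by positivity)]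
      have e2 : stepc T₀.1 ≤ 1 + Real.log (1 + L) := by
        unfold stepc
        have : |(T₀.1 : ℝ)| ≤ L := by
          rw [hLr', ← Int.cast_abs]
          have : |T₀.1| ≤ T₀.2 - T₀.1 := by rw [abs_of_nonpos h1]; omega
          exact_mod_cast this
        gcongr
      have hp : 1 ≤ (L : ℝ) ^ s := Real.one_le_rpow (by exact_mod_cast hL1) hs.le
      have e3 : (4 + 2 / s) * (L : ℝ) ^ s ≤ κ * (L : ℝ) ^ s := by gcongr
      have e4 : (4 + 2 / s) * (L : ℝ) ^ s = 2 * (L : ℝ) ^ s + 2 * ((1 + 1 / s) * (L : ℝ) ^ s) := by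
        ring
      rw [e1]
      linarith
  obtain ⟨Γ, h3, h4⟩ := Finset.exists_max_image (𝒯.powerset.filter fun Γ => Good κ s T₀ 𝒯 Γ)
    Finset.card ⟨{T₀}, by simp [hg]; exact hT⟩
  refine ⟨Γ, (Finset.mem_filter.1 h3).2, fun Γ' hΓ' => h4 Γ' ?_⟩
  simp only [Finset.mem_filter, Finset.mem_powerset]
  exact ⟨hΓ'.1, hΓ'⟩

lemma ends_union (Γ Δ : Finset (ℤ × ℤ)) : ends (Γ ∪ Δ) = ends Γ ∪ ends Δ := by
  ext x; simp only [mem_ends, Finset.mem_union]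
  constructor
  · rintro ⟨T, h | h, hx⟩
    · exact Or.inl ⟨T, h, hx⟩
    · exact Or.inr ⟨T, h, hx⟩
  · rintro (⟨T, h, hx⟩ | ⟨T, h, hx⟩)
    · exact ⟨T, Or.inl h, hx⟩
    · exact ⟨T, Or.inr h, hx⟩

lemma ends_card (Γ : Finset (ℤ × ℤ)) : (ends Γ).card ≤ 2 * Γ.card := by
  unfold ends
  refine (Finset.card_union_le _ _).trans ?_
  have := Finset.card_image_le (s := Γ) (f := Prod.fst)
  have := Finset.card_image_le (s := Γ) (f := Prod.snd)
  omega

lemma count_lemma (κ s : ℝ) (hs : 0 < s) (hκ : 32 ≤ κ) (T₀ : ℤ × ℤ) (𝒯 Γ : Finset (ℤ × ℤ))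
    (hΓ : MaxGood κ s T₀ 𝒯 Γ) (e : ℤ) (he : e ∈ ends Γ) (𝒮 : Finset (ℤ × ℤ)) (h𝒮 : 𝒮 ⊆ 𝒯 \ Γ)
    (l : ℕ) (hl : 1 ≤ l) (hsz : ∀ S ∈ 𝒮, sz S = l) (d : ℝ) (hd : 0 ≤ d)
    (hend : ∀ q ∈ ends 𝒮, |(q : ℝ) - e| ≤ 2 * d) :
    (𝒮.card : ℝ) ≤ d * Real.exp (-(κ * (l : ℝ) ^ s / 8)) := by
  by_contra hcon
  push Not at hcon
  have hn0 : (0 : ℝ) < 𝒮.card := lt_of_le_of_lt (by positivity) hcon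
  have hn0' : 0 < 𝒮.card := by exact_mod_cast hn0
  have hp : 1 ≤ (l : ℝ) ^ s := Real.one_le_rpow (by exact_mod_cast hl) hs.le
  have hdis : Disjoint Γ 𝒮 := by
    rw [Finset.disjoint_left]; intro T h1 h2
    exact (Finset.mem_sdiff.1 (h𝒮 h2)).2 h1
  set lam := Real.exp (κ * (l : ℝ) ^ s / 8) with hlam
  have hlam1 : 1 ≤ lam := Real.one_le_exp (by positivity)
  have hR := hΓ.1.2.2.both e he lam hlam1 (ends 𝒮) (2 * d) (by positivity) hend
  rw [← ends_union] at hR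
  have hm : msum s (Γ ∪ 𝒮) = msum s Γ + 𝒮.card * (l : ℝ) ^ s := by
    unfold msum
    rw [Finset.sum_union hdis]
    congr 1
    rw [← nsmul_eq_mul, ← Finset.sum_const]
    exact Finset.sum_congr rfl fun S hS => by rw [hsz S hS]
  have hgood : Good κ s T₀ 𝒯 (Γ ∪ 𝒮) := by
    refine ⟨Finset.union_subset hΓ.1.1 (h𝒮.trans Finset.sdiff_subset),
      Finset.mem_union_left _ hΓ.1.2.1, hR.mono ?_⟩
    rw [hm, hlam, Real.log_exp]
    have hc : ((ends 𝒮).card : ℝ) ≤ 2 * 𝒮.card := by exact_mod_cast ends_card 𝒮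
    have e1 : ((ends 𝒮).card : ℝ) * (2 * (κ * (l : ℝ) ^ s / 8) + 2) ≤
        (2 * 𝒮.card) * (2 * (κ * (l : ℝ) ^ s / 8) + 2) := by gcongr
    have e2 : 4 / Real.exp (κ * (l : ℝ) ^ s / 8) * (2 * d) ≤ 8 * 𝒮.card := by
      rw [Real.exp_neg] at hcon
      have : 4 / Real.exp (κ * (l : ℝ) ^ s / 8) * (2 * d) =
        8 * (d * (Real.exp (κ * (l : ℝ) ^ s / 8))⁻¹) := by ring
      rw [this]; linarith
    have e3 : (𝒮.card : ℝ) * 32 ≤ 𝒮.card * (κ * (l : ℝ) ^ s) := by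
      gcongr; nlinarith
    nlinarith
  have := hΓ.2 _ hgood
  rw [Finset.card_union_of_disjoint hdis] at this
  omega

lemma sum_inv_le (n : ℕ) : ∑ l ∈ Finset.range n, 1 / ((l : ℝ) * (l + 1)) ≤ 1 := by
  have key : ∀ n : ℕ, ∑ l ∈ Finset.range (n + 1), 1 / ((l : ℝ) * (l + 1)) = 1 - 1 / ((n : ℝ) + 1) := by
    intro n
    induction n with
    | zero => simp
    | succ n ih =>
      rw [Finset.sum_range_succ, ih]
      push_cast
      field_simp
      ring
  rcases n with _ | n
  · simp
  · rw [key]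
    have : 0 ≤ 1 / ((n : ℝ) + 1) := by positivity
    linarith

/-- sites covered by small foreign triangles -/
def Dset (𝒯 Γ : Finset (ℤ × ℤ)) (L : ℕ) : Finset ℤ :=
  ((𝒯 \ Γ).filter fun S => sz S < L).biUnion fun S => Finset.Ico S.1 S.2

lemma density (κ s ε : ℝ) (hs : 0 < s) (hε : 0 < ε) (hκ : 32 ≤ κ)
    (hκε : ∀ l : ℕ, 1 ≤ l → Real.exp (-(κ * (l : ℝ) ^ s / 8)) ≤ ε / (2 * (l : ℝ) ^ 3))
    (T₀ : ℤ × ℤ) (𝒯 Γ : Finset (ℤ × ℤ)) (hTri : Tri 𝒯)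
    (hΓ : MaxGood κ s T₀ 𝒯 Γ) (T : ℤ × ℤ) (hT : T ∈ Γ) (e : ℤ) (he : e = T.1 ∨ e = T.2)
    (d : ℕ) (hd : 1 ≤ d) :
    ((Dset 𝒯 Γ (sz T) ∩ Finset.Ico (e - d) (e + d)).card : ℝ) ≤ ε * d := by
  set L := sz T with hL
  set 𝒢 := (𝒯 \ Γ).filter fun S => sz S < L ∧ |S.1 - e| ≤ 2 * d ∧ |S.2 - e| ≤ 2 * d with h𝒢
  have hsub : Dset 𝒯 Γ L ∩ Finset.Ico (e - d) (e + d) ⊆ 𝒢.biUnion fun S => Finset.Ico S.1 S.2 := by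
    intro x hx
    simp only [Dset, Finset.mem_inter, Finset.mem_biUnion, Finset.mem_filter, Finset.mem_sdiff,
      Finset.mem_Ico] at hx
    obtain ⟨⟨S, ⟨⟨hS, hSΓ⟩, hSL⟩, hxS⟩, hxe⟩ := hx
    rw [Finset.mem_biUnion]
    refine ⟨S, ?_, by simpa using hxS⟩
    have hne : T ≠ S := by rintro rfl; exact hSΓ hT
    have d1 := hTri.2 T (hΓ.1.1 hT) S hS hne e S.1 he (Or.inl rfl)
    have d2 := hTri.2 T (hΓ.1.1 hT) S hS hne e S.2 he (Or.inr rfl)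
    rw [← hL, min_eq_right hSL.le] at d1 d2
    have hlt := hTri.1 S hS
    have hsz : ((sz S : ℕ) : ℤ) = S.2 - S.1 := by simp [sz]; omega
    rw [hsz, le_abs] at d1 d2
    simp only [h𝒢, Finset.mem_filter, Finset.mem_sdiff]
    refine ⟨⟨hS, hSΓ⟩, hSL, ?_, ?_⟩
    · rw [abs_le]; omega
    · rw [abs_le]; omega
  have hc1 : (Dset 𝒯 Γ L ∩ Finset.Ico (e - d) (e + d)).card ≤ ∑ S ∈ 𝒢, sz S := by
    refine (Finset.card_le_card hsub).trans (Finset.card_biUnion_le.trans ?_)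
    apply Finset.sum_le_sum; intro S _; simp [sz]
  have hfib : ∑ S ∈ 𝒢, (sz S : ℝ) =
      ∑ l ∈ Finset.range L, ((𝒢.filter fun S => sz S = l).card : ℝ) * l := by
    rw [← Finset.sum_fiberwise_of_maps_to (s := 𝒢) (t := Finset.range L) (g := sz)]
    · apply Finset.sum_congr rfl
      intro l _
      rw [← nsmul_eq_mul, ← Finset.sum_const]
      exact Finset.sum_congr rfl fun S hS => by rw [(Finset.mem_filter.1 hS).2]
    · intro S hS
      rw [Finset.mem_range]; exact (Finset.mem_filter.1 hS).2.1
  have hterm : ∀ l ∈ Finset.range L, ((𝒢.filter fun S => sz S = l).card : ℝ) * l ≤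
      ε * d * (1 / ((l : ℝ) * (l + 1))) := by
    intro l _
    rcases Nat.eq_zero_or_pos l with h | h
    · subst h; simp
    · have hcnt := count_lemma κ s hs hκ T₀ 𝒯 Γ hΓ e ((mem_ends _ _).2 ⟨T, hT, he⟩)
        (𝒢.filter fun S => sz S = l)
        ((Finset.filter_subset _ _).trans (Finset.filter_subset _ _)) l h
        (fun S hS => (Finset.mem_filter.1 hS).2) d (by positivity) (by
          intro q hq
          obtain ⟨S, hS, hqS⟩ := (mem_ends _ _).1 hq
          have hb := (Finset.mem_filter.1 (Finset.mem_filter.1 hS).1).2.2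
          have : |q - e| ≤ 2 * d := by rcases hqS with rfl | rfl <;> tauto
          exact_mod_cast this)
      have hl1 : (1 : ℝ) ≤ l := by exact_mod_cast h
      calc _ ≤ (d * Real.exp (-(κ * (l : ℝ) ^ s / 8))) * l := by gcongr
        _ ≤ (d * (ε / (2 * (l : ℝ) ^ 3))) * l := by gcongr; exact hκε l h
        _ = ε * d * (1 / (2 * (l : ℝ) ^ 2)) := by field_simp
        _ ≤ _ := by
          have : 1 / (2 * (l : ℝ) ^ 2) ≤ 1 / ((l : ℝ) * (l + 1)) := by
            apply one_div_le_one_div_of_le (by positivity); nlinarith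
          gcongr
  calc _ ≤ ∑ S ∈ 𝒢, (sz S : ℝ) := by exact_mod_cast hc1
    _ = _ := hfib
    _ ≤ _ := Finset.sum_le_sum hterm
    _ = ε * d * ∑ l ∈ Finset.range L, 1 / ((l : ℝ) * (l + 1)) := by rw [Finset.mul_sum]
    _ ≤ ε * d * 1 := by gcongr; exact sum_inv_le L
    _ = ε * d := by ring


/-- parity membership when all other triangles are either foreign-small or large -/
lemma par_local (𝒯 Γ R : Finset (ℤ × ℤ)) (hTri : Tri 𝒯) (hR : R ⊆ 𝒯) (T : ℤ × ℤ) (hT : T ∈ R)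
    (hbig : ∀ S ∈ R, S ∈ Γ → sz T ≤ sz S) (x : ℤ)
    (hx : x ∈ Finset.Ico (T.1 - sz T) (T.2 + sz T)) (hxD : x ∉ Dset 𝒯 Γ (sz T)) :
    x ∈ par R ↔ (¬ (x ∈ Finset.Ico T.1 T.2 ↔
      Odd ((R.erase T).filter fun S => sz T ≤ sz S ∧ T.1 ∈ Finset.Ico S.1 S.2).card)) := by
  have e1 : par R = symmDiff (par (R.erase T)) (Finset.Ico T.1 T.2) := by
    rw [← par_singleton, ← par_union (by simp), Finset.union_comm]
    congr 1
    rw [← Finset.insert_eq, Finset.insert_erase hT]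
  have e2 : (R.erase T).filter (fun S => x ∈ Finset.Ico S.1 S.2) =
      (R.erase T).filter fun S => sz T ≤ sz S ∧ T.1 ∈ Finset.Ico S.1 S.2 := by
    apply Finset.filter_congr
    intro S hS
    have hSR := Finset.mem_of_mem_erase hS
    have hne : T ≠ S := (Finset.ne_of_mem_erase hS).symm
    have hltT := hTri.1 T (hR hT)
    have hltS := hTri.1 S (hR hSR)
    have hszT : ((sz T : ℕ) : ℤ) = T.2 - T.1 := by simp [sz]; omega
    have hszS : ((sz S : ℕ) : ℤ) = S.2 - S.1 := by simp [sz]; omega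
    by_cases hs : sz T ≤ sz S
    · have a1 := hTri.2 T (hR hT) S (hR hSR) hne T.1 S.1 (Or.inl rfl) (Or.inl rfl)
      have a2 := hTri.2 T (hR hT) S (hR hSR) hne T.1 S.2 (Or.inl rfl) (Or.inr rfl)
      have a3 := hTri.2 T (hR hT) S (hR hSR) hne T.2 S.1 (Or.inr rfl) (Or.inl rfl)
      have a4 := hTri.2 T (hR hT) S (hR hSR) hne T.2 S.2 (Or.inr rfl) (Or.inr rfl)
      rw [min_eq_left hs, hszT, le_abs] at a1 a2 a3 a4
      simp only [Finset.mem_Ico] at *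
      omega
    · have hSΓ : S ∉ Γ := fun h => hs (hbig S hSR h)
      have : x ∉ Finset.Ico S.1 S.2 := by
        intro hxS
        apply hxD
        unfold Dset
        rw [Finset.mem_biUnion]
        exact ⟨S, by simp [hR hSR, hSΓ]; omega, hxS⟩
      tauto
  rw [e1, Finset.mem_symmDiff, mem_par, e2]
  tauto

lemma gain_seq (J₁ α ζ ε κ s : ℝ) (h0 : 0 < α) (h1 : α < 1)
    (hζ : ζ = 1 - 2 * ((2 : ℝ) ^ α - 1)) (hε0 : 0 < ε) (hε : ε < 1) (hεζ : 12 * ε ≤ ζ)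
    (hJ : 8 / (α * (1 - α)) ≤ J₁) (hs : 0 < s) (hκ : 32 ≤ κ)
    (hκε : ∀ l : ℕ, 1 ≤ l → Real.exp (-(κ * (l : ℝ) ^ s / 8)) ≤ ε / (2 * (l : ℝ) ^ 3))
    (T₀ : ℤ × ℤ) (𝒯 Γ : Finset (ℤ × ℤ)) (hTri : Tri 𝒯)
    (hΓ : MaxGood κ s T₀ 𝒯 Γ) (R : Finset (ℤ × ℤ)) (hRΓ : R ⊆ Γ)
    (hdown : ∀ T ∈ R, ∀ S ∈ Γ, S ∉ R → sz T ≤ sz S) :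
    ∑ T ∈ R, (J₁ + ζ / (α * (1 - α)) * (sz T : ℝ) ^ α) ≤
      WW J₁ α (par 𝒯) - WW J₁ α (par (𝒯 \ R)) := by
  induction R using Finset.induction_on_max_value sz with
  | empty => simp
  | insert T R hT hmax ih =>
    have hTΓ : T ∈ Γ := hRΓ (Finset.mem_insert_self _ _)
    have ih := ih ((Finset.subset_insert _ _).trans hRΓ) (by
      intro T' hT' S hS hSR
      by_cases h : S = T
      · subst h; exact hmax T' hT'
      · exact hdown T' (Finset.mem_insert_of_mem hT') S hS (by simp [h, hSR]))
    rw [Finset.sum_insert hT]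
    have hTm : T ∈ 𝒯 \ R := Finset.mem_sdiff.2 ⟨hΓ.1.1 hTΓ, hT⟩
    have e1 : par (𝒯 \ insert T R) = symmDiff (par (𝒯 \ R)) (Finset.Ico T.1 T.2) := by
      rw [← par_singleton, ← par_sdiff (by simpa using hTm)]
      congr 1
      ext S; simp; tauto
    have hlt := hTri.1 T (hΓ.1.1 hTΓ)
    have hszT : ((sz T : ℕ) : ℤ) = T.2 - T.1 := by simp [sz]; omega
    have hT2 : T.2 = T.1 + sz T := by omega
    have hbig : ∀ S ∈ 𝒯 \ R, S ∈ Γ → sz T ≤ sz S := by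
      intro S hS hSΓ
      by_cases h : S = T
      · subst h; exact le_rfl
      · exact hdown T (Finset.mem_insert_self _ _) S hSΓ
          (by simp [h]; exact (Finset.mem_sdiff.1 hS).2)
    have hloc := par_local 𝒯 Γ (𝒯 \ R) hTri Finset.sdiff_subset T hTm hbig
    set η₀ : Prop := Odd (((𝒯 \ R).erase T).filter fun S =>
      sz T ≤ sz S ∧ T.1 ∈ Finset.Ico S.1 S.2).card
    have hgain := gain_triangle J₁ α ζ ε h0 h1 hζ hε0.le hε hεζ hJ (par (𝒯 \ R))
      (Dset 𝒯 Γ (sz T)) T.1 (sz T) (by omega) (¬ η₀) (by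
        intro x hx hxD
        rw [hloc x (by simp at hx ⊢; omega) hxD]
        rw [← hT2] at hx
        tauto) (by
        intro x hx hxD
        have : x ∉ Finset.Ico T.1 T.2 := by simp at hx ⊢; omega
        rw [hloc x (by simp at hx ⊢; omega) hxD]
        tauto) (by
        intro e he d hd _
        exact density κ s ε hs hε0 hκ hκε T₀ 𝒯 Γ hTri hΓ T hTΓ e (by rw [hT2]; exact he) d hd)
    rw [← hT2, ← e1] at hgain
    linarith


lemma pow_le_sum (s : ℝ) (hs1 : s < 1) (L : ℕ) (hL : 1 ≤ L) :
    (L : ℝ) ^ s ≤ ∑ l ∈ Finset.Icc 1 L, (l : ℝ) ^ (s - 1) := by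
  have hl1 : (1 : ℝ) ≤ L := by exact_mod_cast hL
  have : ∑ l ∈ Finset.Icc 1 L, (L : ℝ) ^ (s - 1) ≤ ∑ l ∈ Finset.Icc 1 L, (l : ℝ) ^ (s - 1) := by
    apply Finset.sum_le_sum
    intro l hl
    rw [Finset.mem_Icc] at hl
    apply Real.rpow_le_rpow_of_nonpos
    · exact_mod_cast hl.1
    · exact_mod_cast hl.2
    · linarith
  refine le_trans (le_of_eq ?_) this
  rw [Finset.sum_const, nsmul_eq_mul, Real.rpow_sub_one (by linarith)]
  simp
  field_simp

lemma sum_pow_le (p : ℝ) (hp : 0 < p) (hp1 : p < 1) (L : ℕ) (hL : 1 ≤ L) :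
    ∑ l ∈ Finset.Icc 1 L, (l : ℝ) ^ (p - 1) ≤ (L : ℝ) ^ p / p := by
  induction L, hL using Nat.le_induction with
  | base => simp; exact (one_le_inv₀ hp).2 hp1.le
  | succ L hL ih =>
    rw [Finset.sum_Icc_succ_top (by omega)]
    have h := pk_pow_lo p L hp hp1 (by exact_mod_cast hL)
    push_cast
    rw [le_div_iff₀ hp] at *
    linarith

/-- number of triangles of size at least `l` -/
def NN (Γ : Finset (ℤ × ℤ)) (l : ℕ) : ℕ := (Γ.filter fun T => l ≤ sz T).card

lemma sum_layers (Γ : Finset (ℤ × ℤ)) (f : ℕ → ℝ) (m : ℕ) (hm : ∀ T ∈ Γ, sz T ≤ m) :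
    ∑ T ∈ Γ, ∑ l ∈ Finset.Icc 1 (sz T), f l = ∑ l ∈ Finset.Icc 1 m, (NN Γ l : ℝ) * f l := by
  have e : ∀ T ∈ Γ, ∑ l ∈ Finset.Icc 1 (sz T), f l =
      ∑ l ∈ Finset.Icc 1 m, if l ≤ sz T then f l else 0 := by
    intro T hT
    rw [← Finset.sum_filter]
    congr 1
    ext l; have := hm T hT; simp; omega
  rw [Finset.sum_congr rfl e, Finset.sum_comm]
  apply Finset.sum_congr rfl
  intro l _
  rw [← Finset.sum_filter, Finset.sum_const, nsmul_eq_mul]; rfl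

lemma level (s s' : ℝ) (hs : 0 < s) (hss : s < s') (hs1 : s' < 1) :
    ∃ C : ℝ, 0 < C ∧ ∃ M : ℕ, ∀ Γ : Finset (ℤ × ℤ), Γ.Nonempty → (∀ T ∈ Γ, 1 ≤ sz T) →
      ∃ (l : ℕ) (n : ℝ), 1 ≤ l ∧ 0 < n ∧ msum s Γ ≤ C * (n * (l : ℝ) ^ s') ∧
        ∑ T ∈ Γ.filter (fun T => sz T ≤ M * l), (sz T : ℝ) ≤ C * (n * l) ∧
        n / 2 ≤ ((Γ.filter fun T => l ≤ sz T ∧ sz T ≤ M * l).card : ℝ) := by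
  have hs'0 : 0 < s' := by linarith
  have hsum : Summable (fun l : ℕ => (l : ℝ) ^ (s - 1 - s')) := by
    rw [Real.summable_nat_rpow]; linarith
  set C₁ := ∑' l : ℕ, (l : ℝ) ^ (s - 1 - s') with hC₁
  obtain ⟨M, hM⟩ := exists_nat_gt ((2 : ℝ) ^ (1 / s'))
  have hM1 : (1 : ℝ) ≤ M := by
    have : (1 : ℝ) ≤ (2 : ℝ) ^ (1 / s') := Real.one_le_rpow (by norm_num) (by positivity)
    linarith
  have hM2 : 2 ≤ (M : ℝ) ^ s' := by
    have := Real.rpow_le_rpow (by positivity) hM.le hs'0.le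
    rwa [← Real.rpow_mul (by norm_num), one_div, inv_mul_cancel₀ hs'0.ne', Real.rpow_one] at this
  have hC₁0 : 0 ≤ C₁ := tsum_nonneg fun l => by positivity
  have hp : 0 < 1 - s' := by linarith
  refine ⟨C₁ + (M : ℝ) ^ (1 - s') / (1 - s') + 1, by positivity, M, ?_⟩
  intro Γ hne hsz
  set m := Γ.sup sz with hm
  have hle : ∀ T ∈ Γ, sz T ≤ m := fun T hT => Finset.le_sup hT
  have hm1 : 1 ≤ m := by
    obtain ⟨T, hT⟩ := hne
    exact (hsz T hT).trans (hle T hT)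
  obtain ⟨l, hl, hmax⟩ := Finset.exists_max_image (Finset.Icc 1 m)
    (fun l => (NN Γ l : ℝ) * (l : ℝ) ^ s') ⟨1, by simp [hm1]⟩
  rw [Finset.mem_Icc] at hl
  have hl1 : (1 : ℝ) ≤ l := by exact_mod_cast hl.1
  have hN1 : NN Γ 1 = Γ.card := by
    unfold NN; rw [Finset.filter_true_of_mem hsz]
  have hX : 0 < (NN Γ l : ℝ) * (l : ℝ) ^ s' := by
    have := hmax 1 (by simp [hm1])
    rw [hN1] at this
    have hc : (0 : ℝ) < Γ.card := by exact_mod_cast Finset.card_pos.2 hne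
    simp at this
    linarith
  have hn : (0 : ℝ) < NN Γ l := by
    by_contra h
    have : (NN Γ l : ℝ) = 0 := le_antisymm (not_lt.1 h) (by positivity)
    rw [this] at hX; simp at hX
  have hall : ∀ k : ℕ, 1 ≤ k → (NN Γ k : ℝ) * (k : ℝ) ^ s' ≤ (NN Γ l : ℝ) * (l : ℝ) ^ s' := by
    intro k hk
    by_cases hkm : k ≤ m
    · exact hmax k (by simp [hk, hkm])
    · have : NN Γ k = 0 := by
        unfold NN
        rw [Finset.card_eq_zero, Finset.filter_eq_empty_iff]
        intro T hT; have := hle T hT; omega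
      rw [this]; simp; positivity
  set X := (NN Γ l : ℝ) * (l : ℝ) ^ s' with hXdef
  have hNk : ∀ k : ℕ, 1 ≤ k → (NN Γ k : ℝ) ≤ X * (k : ℝ) ^ (-s') := by
    intro k hk
    have hk0 : (0 : ℝ) < k := by exact_mod_cast hk
    have := hall k hk
    rw [Real.rpow_neg hk0.le, ← div_eq_mul_inv, le_div_iff₀ (by positivity)]
    exact this
  refine ⟨l, NN Γ l, hl.1, hn, ?_, ?_, ?_⟩
  · have b1 : msum s Γ ≤ ∑ T ∈ Γ, ∑ k ∈ Finset.Icc 1 (sz T), (k : ℝ) ^ (s - 1) := by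
      apply Finset.sum_le_sum
      intro T hT
      exact pow_le_sum s (by linarith) (sz T) (hsz T hT)
    rw [sum_layers Γ (fun k => (k : ℝ) ^ (s - 1)) m hle] at b1
    have b2 : ∑ k ∈ Finset.Icc 1 m, (NN Γ k : ℝ) * (k : ℝ) ^ (s - 1) ≤
        ∑ k ∈ Finset.Icc 1 m, X * (k : ℝ) ^ (s - 1 - s') := by
      apply Finset.sum_le_sum
      intro k hk
      have hk1 := (Finset.mem_Icc.1 hk).1
      have hk0 : (0 : ℝ) < k := by exact_mod_cast hk1
      calc _ ≤ (X * (k : ℝ) ^ (-s')) * (k : ℝ) ^ (s - 1) := by gcongr; exact hNk k hk1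
        _ = _ := by
          rw [mul_assoc, ← Real.rpow_add hk0]; congr 2; ring
    rw [← Finset.mul_sum] at b2
    have b3 : ∑ k ∈ Finset.Icc 1 m, (k : ℝ) ^ (s - 1 - s') ≤ C₁ :=
      hsum.sum_le_tsum _ fun k _ => by positivity
    have b4 : 0 ≤ (M : ℝ) ^ (1 - s') / (1 - s') := by positivity
    calc _ ≤ _ := b1
      _ ≤ _ := b2
      _ ≤ X * C₁ := by gcongr
      _ ≤ _ := by rw [mul_comm]; gcongr; linarith
  · set R := Γ.filter (fun T => sz T ≤ M * l) with hR
    have b1 : ∑ T ∈ R, (sz T : ℝ) = ∑ T ∈ R, ∑ k ∈ Finset.Icc 1 (sz T), (1 : ℝ) := by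
      apply Finset.sum_congr rfl; intro T _; simp
    rw [b1, sum_layers R (fun _ => 1) (M * l) (fun T hT => (Finset.mem_filter.1 hT).2)]
    have b2 : ∑ k ∈ Finset.Icc 1 (M * l), (NN R k : ℝ) * 1 ≤
        ∑ k ∈ Finset.Icc 1 (M * l), X * (k : ℝ) ^ ((1 - s') - 1) := by
      apply Finset.sum_le_sum
      intro k hk
      have hk1 := (Finset.mem_Icc.1 hk).1
      rw [mul_one, show (1 - s') - 1 = -s' by ring]
      refine le_trans ?_ (hNk k hk1)
      unfold NN
      exact_mod_cast Finset.card_le_card (Finset.filter_subset_filter _ (Finset.filter_subset _ _))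
    rw [← Finset.mul_sum] at b2
    have hMl : 1 ≤ M * l := by
      have : 1 ≤ M := by exact_mod_cast hM1
      exact Nat.mul_pos this hl.1
    have b3 := sum_pow_le (1 - s') hp (by linarith) (M * l) hMl
    calc _ ≤ _ := b2
      _ ≤ X * (((M * l : ℕ) : ℝ) ^ (1 - s') / (1 - s')) := by gcongr
      _ = ((M : ℝ) ^ (1 - s') / (1 - s')) * (NN Γ l * ((l : ℝ) ^ s' * (l : ℝ) ^ (1 - s'))) := by
        push_cast
        rw [Real.mul_rpow (by positivity) (by positivity), hXdef]; ring
      _ = ((M : ℝ) ^ (1 - s') / (1 - s')) * (NN Γ l * l) := by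
        rw [← Real.rpow_add (by linarith)]; simp
      _ ≤ _ := by gcongr; linarith
  · have hsplit : NN Γ l ≤ (Γ.filter fun T => l ≤ sz T ∧ sz T ≤ M * l).card + NN Γ (M * l + 1) := by
      unfold NN
      rw [← Finset.card_union_of_disjoint]
      · apply Finset.card_le_card
        intro T hT
        simp only [Finset.mem_filter, Finset.mem_union] at *
        by_cases h : sz T ≤ M * l
        · exact Or.inl ⟨hT.1, hT.2, h⟩
        · exact Or.inr ⟨hT.1, by omega⟩
      · rw [Finset.disjoint_left]; intro T; simp; intro _ _ h _; omega
    have hb := hall (M * l + 1) (by omega)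
    have h2 : (M : ℝ) ^ s' * (l : ℝ) ^ s' ≤ ((M * l + 1 : ℕ) : ℝ) ^ s' := by
      rw [← Real.mul_rpow (by positivity) (by positivity)]
      apply Real.rpow_le_rpow (by positivity) _ hs'0.le
      push_cast; linarith
    have hls : 0 < (l : ℝ) ^ s' := by positivity
    have h3 : (NN Γ (M * l + 1) : ℝ) * (2 * (l : ℝ) ^ s') ≤ NN Γ l * (l : ℝ) ^ s' := by
      refine le_trans ?_ hb
      gcongr
      refine le_trans ?_ h2
      gcongr
    have h4 : (NN Γ (M * l + 1) : ℝ) * 2 ≤ NN Γ l := by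
      by_contra hcon
      push Not at hcon
      have := mul_lt_mul_of_pos_right hcon hls
      linarith
    have h5 : (NN Γ l : ℝ) ≤ ((Γ.filter fun T => l ≤ sz T ∧ sz T ≤ M * l).card : ℝ) +
        NN Γ (M * l + 1) := by exact_mod_cast hsplit
    linarith

lemma exists_Jmin (c α r K : ℝ) (hc : 0 < c) (hr : 0 < r) (hra : r < α) (hK : 0 ≤ K) :
    ∃ J₀ : ℝ, ∀ J₁ : ℝ, J₀ ≤ J₁ → ∀ l : ℕ, 1 ≤ l → K * (l : ℝ) ^ r ≤ J₁ + c * (l : ℝ) ^ α := by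
  obtain ⟨m, hm⟩ := exists_nat_gt ((K / c) ^ (1 / (α - r)))
  refine ⟨K * (m : ℝ) ^ r, ?_⟩
  intro J₁ hJ l hl
  have hl0 : (0 : ℝ) < l := by exact_mod_cast hl
  have hd : 0 < α - r := by linarith
  rcases le_total l m with h | h
  · have : K * (l : ℝ) ^ r ≤ K * (m : ℝ) ^ r := by gcongr
    have : 0 ≤ c * (l : ℝ) ^ α := by positivity
    linarith
  · have h1 : (K / c) ^ (1 / (α - r)) ≤ l := by
      have : (m : ℝ) ≤ l := by exact_mod_cast h
      linarith
    have h2 := Real.rpow_le_rpow (by positivity) h1 hd.le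
    rw [← Real.rpow_mul (by positivity), one_div, inv_mul_cancel₀ hd.ne', Real.rpow_one,
      div_le_iff₀ hc] at h2
    have h3 : (l : ℝ) ^ α = (l : ℝ) ^ (α - r) * (l : ℝ) ^ r := by
      rw [← Real.rpow_add hl0]; congr 1; ring
    have h4 : K * (l : ℝ) ^ r ≤ ((l : ℝ) ^ (α - r) * c) * (l : ℝ) ^ r := by gcongr
    have h5 : 0 ≤ J₁ := le_trans (by positivity) hJ
    rw [h3]; linarith


/-- marked positions of a marked walk -/
def mvis : ℤ → List (ℤ × Bool) → List ℤ
  | _, [] => []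
  | x, s :: l => if s.2 then (x + s.1) :: mvis (x + s.1) l else mvis (x + s.1) l

/-- cost of a marked walk -/
def mcost (l : List (ℤ × Bool)) : ℝ := (l.map fun s => stepc s.1).sum

/-- the flipped region coded by a marked walk -/
def IS (N : ℕ) (l : List (ℤ × Bool)) : Finset ℤ :=
  (Finset.Icc (-(N : ℤ)) N).filter fun x => Odd ((mvis 0 l).toFinset.filter fun p => p ≤ x).card

lemma mark_exists (P : Finset ℤ) : ∀ (l : List ℤ) (x : ℤ), ∃ ml : List (ℤ × Bool),
    ml.map Prod.fst = l ∧ ∀ y, y ∈ mvis x ml ↔ (y ∈ vis x l ∧ y ∈ P) := by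
  intro l
  induction l with
  | nil => intro x; exact ⟨[], rfl, by simp [mvis, vis]⟩
  | cons s l ih =>
    intro x
    obtain ⟨ml, h1, h2⟩ := ih (x + s)
    refine ⟨(s, decide (x + s ∈ P)) :: ml, by simp [h1], ?_⟩
    intro y
    by_cases h : x + s ∈ P
    · simp only [mvis, vis, h, decide_true, if_true, List.mem_cons, h2]
      constructor
      · rintro (rfl | h3)
        · exact ⟨Or.inl rfl, h⟩
        · exact ⟨Or.inr h3.1, h3.2⟩
      · tauto
    · simp only [mvis, vis, h, decide_false, List.mem_cons, h2]
      simp only [Bool.false_eq_true, if_false, h2]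
      constructor
      · tauto
      · rintro ⟨rfl | h3, h4⟩
        · exact absurd h4 h
        · exact ⟨h3, h4⟩

lemma mcost_eq (ml : List (ℤ × Bool)) : mcost ml = wcost (ml.map Prod.fst) := by
  simp [mcost, wcost, Function.comp_def]

set_option maxHeartbeats 2000000 in
lemma deterministic (α ζ K : ℝ) (hα : 1 / 2 < α) (h1 : α < 1) (hζ0 : 0 < ζ)
    (hζ : ζ = 1 - 2 * ((2 : ℝ) ^ α - 1)) (hK : 0 < K) :
    ∃ J₀ : ℝ, ∀ J₁ : ℝ, J₀ ≤ J₁ → 0 ≤ J₁ ∧ ∀ (N : ℕ) (A : Finset ℤ),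
      A ⊆ Finset.Icc (-(N : ℤ)) N → (0 : ℤ) ∈ A →
      ∃ l : List (ℤ × Bool), l ≠ [] ∧
        K * mcost l ≤ WW J₁ α A - WW J₁ α (symmDiff A (IS N l)) ∧
        K * mcost l * (IS N l).card ≤ (WW J₁ α A - WW J₁ α (symmDiff A (IS N l))) ^ 2 := by
  have h0 : 0 < α := by linarith
  have h1' : 0 < 1 - α := by linarith
  have hζ1 : ζ < 1 := by
    have : (1 : ℝ) < 2 ^ α := Real.one_lt_rpow (by norm_num) h0
    linarith
  obtain ⟨s, s', hs, hss, hs1, hs2⟩ : ∃ s s' : ℝ, 0 < s ∧ s < s' ∧ s' < 1 ∧ 1 + s' < 2 * α :=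
    ⟨(2 * α - 1) / 3, 2 * (2 * α - 1) / 3, by linarith, by linarith, by linarith, by linarith⟩
  have hs'0 : 0 < s' := by linarith
  set ε := ζ / 24 with hε
  have hε0 : 0 < ε := by positivity
  obtain ⟨κ, hκ32, hκs, hκε⟩ := exists_kappa s ε hs hε0
  obtain ⟨C, hC, M, hlevel⟩ := level s s' hs hss hs1
  set K₃ := 2 * K * κ * C + 4 * K * κ * C ^ 2 + 1 with hK₃
  have hκ0 : 0 < κ := by linarith
  have hA0 : 0 ≤ 2 * K * κ * C := by positivity
  have hB0 : 0 ≤ 4 * K * κ * C ^ 2 := by positivity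
  set c := ζ / (α * (1 - α)) with hc
  have hc0 : 0 < c := by positivity
  set r := (1 + s') / 2 with hr
  obtain ⟨J₀, hJ₀⟩ := exists_Jmin c α r K₃ hc0 (by linarith) (by linarith) (by linarith)
  refine ⟨max J₀ (8 / (α * (1 - α))), ?_⟩
  intro J₁ hJ
  have hJ8 : 8 / (α * (1 - α)) ≤ J₁ := (le_max_right _ _).trans hJ
  have hJ0 : 0 ≤ J₁ := le_trans (by positivity) hJ8
  have hJm := hJ₀ J₁ ((le_max_left _ _).trans hJ)
  refine ⟨hJ0, ?_⟩
  intro N A hAN h0A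
  obtain ⟨𝒯, hTri, hends, hpar⟩ := exists_triangles A
  obtain ⟨T₀, hT₀, hT₀1, hT₀2⟩ : ∃ T₀ ∈ 𝒯, T₀.1 ≤ 0 ∧ 0 < T₀.2 := by
    rw [← hpar, mem_par] at h0A
    obtain ⟨T, hT⟩ := Finset.card_pos.1 h0A.pos
    simp only [Finset.mem_filter, Finset.mem_Ico] at hT
    exact ⟨T, hT.1, hT.2⟩
  obtain ⟨Γ, hΓ⟩ := exists_maxGood κ s hs hκs T₀ 𝒯 hT₀ hT₀1 hT₀2
  have hsz : ∀ T ∈ Γ, 1 ≤ sz T := by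
    intro T hT; have := hTri.1 T (hΓ.1.1 hT); simp [sz]; omega
  obtain ⟨k, n, hk, hn, hl1, hl2, hl3⟩ := hlevel Γ ⟨T₀, hΓ.1.2.1⟩ hsz
  set R := Γ.filter (fun T => sz T ≤ M * k) with hR
  have hRΓ : R ⊆ Γ := Finset.filter_subset _ _
  have hgain := gain_seq J₁ α ζ ε κ s h0 h1 hζ hε0 (by linarith) (by linarith) hJ8 hs hκ32 hκε
    T₀ 𝒯 Γ hTri hΓ R hRΓ (by
      intro T hT S hS hSR
      have a1 := (Finset.mem_filter.1 hT).2
      have a2 : ¬ sz S ≤ M * k := fun h => hSR (Finset.mem_filter.2 ⟨hS, h⟩)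
      omega)
  obtain ⟨w, hw1, hw2⟩ := hΓ.1.2.2
  obtain ⟨ml, hml1, hml2⟩ := mark_exists (ends R) w 0
  have hfin : (mvis 0 ml).toFinset = ends R := by
    ext y
    rw [List.mem_toFinset, hml2]
    constructor
    · exact fun h => h.2
    · intro h
      refine ⟨hw1 y ?_, h⟩
      obtain ⟨T, hT, hy⟩ := (mem_ends _ _).1 h
      exact (mem_ends _ _).2 ⟨T, hRΓ hT, hy⟩
  have hRTri : Tri R := hTri.mono (hRΓ.trans hΓ.1.1)
  have hIS : IS N ml = par R := by
    ext x
    unfold IS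
    rw [Finset.mem_filter, hfin, ← par_ends R hRTri, and_iff_right_iff_imp]
    intro hx
    unfold par at hx
    obtain ⟨T, hT, hxT⟩ := Finset.mem_biUnion.1 (Finset.mem_filter.1 hx).1
    have hb : ∀ e, (e = T.1 ∨ e = T.2) → -(N : ℤ) ≤ e ∧ e ≤ N + 1 := by
      intro e he
      have : e ∈ bdry A := by
        rw [← hends]; exact (mem_ends _ _).2 ⟨T, hΓ.1.1 (hRΓ hT), he⟩
      rw [mem_bdry] at this
      by_cases h : e ∈ A
      · have := hAN h; simp at this; omega
      · have h2 : e - 1 ∈ A := by tauto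
        have := hAN h2; simp at this; omega
    have b1 := hb T.1 (Or.inl rfl)
    have b2 := hb T.2 (Or.inr rfl)
    simp only [Finset.mem_Ico, Finset.mem_Icc] at *
    omega
  have hsym : par (𝒯 \ R) = symmDiff A (IS N ml) := by
    rw [par_sdiff (hRΓ.trans hΓ.1.1), hpar, hIS]
  rw [hsym, hpar] at hgain
  set g := WW J₁ α A - WW J₁ α (symmDiff A (IS N ml)) with hg
  have hkr : (1 : ℝ) ≤ k := by exact_mod_cast hk
  have hg1 : n / 2 * (K₃ * (k : ℝ) ^ r) ≤ g := by
    refine le_trans ?_ hgain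
    have hsub : (Γ.filter fun T => k ≤ sz T ∧ sz T ≤ M * k) ⊆ R := by
      intro T; simp only [hR, Finset.mem_filter]; tauto
    refine le_trans ?_ (Finset.sum_le_sum_of_subset_of_nonneg hsub fun T _ _ => by positivity)
    have hterm : ∀ T ∈ Γ.filter fun T => k ≤ sz T ∧ sz T ≤ M * k,
        K₃ * (k : ℝ) ^ r ≤ J₁ + c * (sz T : ℝ) ^ α := by
      intro T hT
      have hkT : (k : ℝ) ≤ sz T := by exact_mod_cast (Finset.mem_filter.1 hT).2.1
      refine (hJm k hk).trans ?_
      gcongr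
    refine le_trans ?_ (Finset.sum_le_sum hterm)
    rw [Finset.sum_const, nsmul_eq_mul]
    gcongr
  have hcost : mcost ml ≤ κ * (C * (n * (k : ℝ) ^ s')) := by
    rw [mcost_eq, hml1]
    refine hw2.trans ?_
    gcongr
  have hcard : ((IS N ml).card : ℝ) ≤ C * (n * k) := by
    rw [hIS]
    refine le_trans ?_ hl2
    exact_mod_cast par_card_le R
  have hs'r : (k : ℝ) ^ s' ≤ (k : ℝ) ^ r := Real.rpow_le_rpow_of_exponent_le hkr (by linarith)
  have hkrp : 0 < (k : ℝ) ^ r := by positivity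
  have hmc0 : 0 ≤ mcost ml := by
    unfold mcost
    apply List.sum_nonneg
    intro x hx
    obtain ⟨y, _, rfl⟩ := List.mem_map.1 hx
    linarith [stepc_ge y.1]
  refine ⟨ml, ?_, ?_, ?_⟩
  · rintro rfl
    simp only [List.map_nil] at hml1
    have := hw1 T₀.1 ((mem_ends _ _).2 ⟨T₀, hΓ.1.2.1, Or.inl rfl⟩)
    rw [← hml1] at this
    simp [vis] at this
  · refine le_trans ?_ hg1
    calc K * mcost ml ≤ K * (κ * (C * (n * (k : ℝ) ^ s'))) := by gcongr
      _ ≤ K * (κ * (C * (n * (k : ℝ) ^ r))) := by gcongr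
      _ = n / 2 * ((2 * K * κ * C) * (k : ℝ) ^ r) := by ring
      _ ≤ _ := by gcongr; linarith
  · have hsq : (n / 2 * (K₃ * (k : ℝ) ^ r)) ^ 2 ≤ g ^ 2 := by
      refine pow_le_pow_left₀ ?_ hg1 2
      have : 0 ≤ K₃ := by linarith
      clear_value K₃ r
      positivity
    refine le_trans ?_ hsq
    have hkk : (k : ℝ) ^ s' * k = ((k : ℝ) ^ r) ^ 2 := by
      rw [← Real.rpow_natCast, ← Real.rpow_mul (by linarith), ← Real.rpow_add_one (by linarith)]
      congr 1; push_cast; rw [hr]; ring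
    calc K * mcost ml * (IS N ml).card ≤ K * (κ * (C * (n * (k : ℝ) ^ s'))) * (C * (n * k)) := by
          gcongr
      _ = (n / 2) ^ 2 * ((4 * K * κ * C ^ 2) * ((k : ℝ) ^ s' * k)) := by ring
      _ = (n / 2) ^ 2 * ((4 * K * κ * C ^ 2) * ((k : ℝ) ^ r) ^ 2) := by rw [hkk]
      _ ≤ (n / 2) ^ 2 * (K₃ ^ 2 * ((k : ℝ) ^ r) ^ 2) := by
          have h5 : 4 * K * κ * C ^ 2 ≤ K₃ ^ 2 := by
            generalize 4 * K * κ * C ^ 2 = y at *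
            generalize 2 * K * κ * C = x at *
            rw [hK₃]; nlinarith
          gcongr
      _ = _ := by ring


lemma jz_tsum (J₁ α : ℝ) (h1 : α < 1) : HasSum (jz J₁ α) (2 * tailJ J₁ α 1) := by
  have hs := Jcoup_summable J₁ α h1
  have hs1 := (summable_nat_add_iff 1).2 hs
  have e1 : HasSum (fun n : ℕ => jz J₁ α n) (tailJ J₁ α 1) := by
    have : tailJ J₁ α 1 = tailJ J₁ α 0 := by
      rw [tailJ_rec J₁ α h1 0, Jcoup_zero _ _ h1]; simp
    rw [this]
    have := hs.hasSum
    simpa [jz, tailJ] using this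
  have e2 : HasSum (fun n : ℕ => jz J₁ α (-(n + 1 : ℤ))) (tailJ J₁ α 1) := by
    have := hs1.hasSum
    unfold tailJ
    have e : (fun n : ℕ => jz J₁ α (-(n + 1 : ℤ))) = fun n : ℕ => Jcoup J₁ α (n + 1) := by
      funext n
      rw [jz_neg]
      unfold jz
      congr 1
    rw [e]
    exact this
  have := HasSum.of_nat_of_neg_add_one e1 e2
  rwa [← two_mul] at this

lemma outer_tsum (J₁ α : ℝ) (h1 : α < 1) (Λ : Finset ℤ) (i : ℤ) :
    (∑' j : ℤ, if j ∈ Λ then 0 else Jcoup J₁ α (i - j).natAbs) =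
      2 * tailJ J₁ α 1 - qs J₁ α i Λ := by
  have e1 : HasSum (fun j : ℤ => jz J₁ α (i - j)) (2 * tailJ J₁ α 1) :=
    by
    have := (Equiv.hasSum_iff (f := jz J₁ α) (a := 2 * tailJ J₁ α 1) (Equiv.subLeft i)).2
      (jz_tsum J₁ α h1)
    exact this
  have e2 : HasSum (fun j : ℤ => if j ∈ Λ then jz J₁ α (i - j) else 0) (qs J₁ α i Λ) := by
    have : qs J₁ α i Λ = ∑ j ∈ Λ, if j ∈ Λ then jz J₁ α (i - j) else 0 := by
      unfold qs
      refine Finset.sum_congr rfl fun j hj => ?_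
      rw [if_pos hj, jz_comm]
    rw [this]
    apply hasSum_sum_of_ne_finset_zero
    intro j hj; simp [hj]
  have := (e1.sub e2).tsum_eq
  rw [← this]
  congr 1
  funext j
  split_ifs <;> simp [jz]

/-- the set of `false` sites -/
def mset (Λ : Finset ℤ) (σ : Λ → Bool) : Finset ℤ :=
  Λ.filter fun i => ∃ hi : i ∈ Λ, σ ⟨i, hi⟩ = false

lemma mem_mset (Λ : Finset ℤ) (σ : Λ → Bool) (i : Λ) : (i : ℤ) ∈ mset Λ σ ↔ σ i = false := by
  simp [mset]

lemma spin_mset (Λ : Finset ℤ) (σ : Λ → Bool) (i : Λ) :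
    spin (σ i) = 1 - 2 * (if (i : ℤ) ∈ mset Λ σ then 1 else 0) := by
  have := mem_mset Λ σ i
  by_cases hm : (i : ℤ) ∈ mset Λ σ
  · rw [if_pos hm, this.1 hm]; simp [spin]; norm_num
  · rw [if_neg hm]
    have : ¬ σ i = false := fun h => hm (this.2 h)
    simp [spin, this]

lemma mset_sub (Λ : Finset ℤ) (σ : Λ → Bool) : mset Λ σ ⊆ Λ := Finset.filter_subset _ _

lemma sum_mset (Λ : Finset ℤ) (F : Finset ℤ → ℝ) :
    ∑ σ : Λ → Bool, F (mset Λ σ) = ∑ A ∈ Λ.powerset, F A := by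
  refine Finset.sum_bij' (fun σ _ => mset Λ σ) (fun A _ => fun i => decide ((i : ℤ) ∉ A))
    ?_ ?_ ?_ ?_ ?_
  · intro σ _; simpa using mset_sub Λ σ
  · intro A _; simp
  · intro σ _
    funext i
    have := mem_mset Λ σ i
    cases h : σ i <;> simp [this, h]
  · intro A hA
    ext x
    simp only [Finset.mem_powerset] at hA
    simp only [mset, Finset.mem_filter]
    constructor
    · rintro ⟨h, h', h2⟩; simpa using h2
    · intro h; exact ⟨hA h, hA h, by simpa using h⟩
  · intro σ _; rfl

lemma ham_eq (J₁ α θ : ℝ) (h1 : α < 1) (Λ : Finset ℤ) (h : ℤ → ℝ) (σ : Λ → Bool) :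
    Ham J₁ α θ 1 Λ h σ = 2 * WW J₁ α (mset Λ σ) - θ * ∑ i ∈ Λ, h i
      + 2 * θ * ∑ i ∈ mset Λ σ, h i := by
  set A := mset Λ σ with hA
  have hAΛ : A ⊆ Λ := mset_sub Λ σ
  set χ : ℤ → ℝ := fun x => if x ∈ A then 1 else 0 with hχ
  have hsp : ∀ i : Λ, spin (σ i) = 1 - 2 * χ i := fun i => spin_mset Λ σ i
  have hres : ∀ F : ℤ → ℝ, ∑ i ∈ Λ, χ i * F i = ∑ i ∈ A, F i := by
    intro F
    rw [← Finset.sum_subset hAΛ (f := fun i => χ i * F i)]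
    · exact Finset.sum_congr rfl fun i hi => by simp [hχ, hi]
    · intro x _ hx; simp [hχ, hx]
  have t1 : ∑ i : Λ, ∑ j : Λ, (if i = j then 0 else
      Jcoup J₁ α ((i : ℤ) - (j : ℤ)).natAbs * (1 - spin (σ i) * spin (σ j)))
      = ∑ i ∈ Λ, ∑ j ∈ Λ, jz J₁ α (j - i) * (2 * χ i + 2 * χ j - 4 * (χ i * χ j)) := by
    rw [← Finset.sum_coe_sort Λ]
    refine Finset.sum_congr rfl fun i _ => ?_
    rw [← Finset.sum_coe_sort Λ]
    refine Finset.sum_congr rfl fun j _ => ?_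
    split_ifs with hij
    · rw [hij, sub_self, jz_zero _ _ h1, zero_mul]
    · rw [hsp, hsp, jz_comm]; unfold jz; ring
  have t2 : ∑ i ∈ Λ, ∑ j ∈ Λ, jz J₁ α (j - i) * (2 * χ i + 2 * χ j - 4 * (χ i * χ j)) =
      4 * ∑ i ∈ A, qs J₁ α i Λ - 4 * ∑ i ∈ A, qs J₁ α i A := by
    have a1 : ∑ i ∈ Λ, ∑ j ∈ Λ, jz J₁ α (j - i) * χ i = ∑ i ∈ A, qs J₁ α i Λ := by
      rw [← hres]
      refine Finset.sum_congr rfl fun i _ => ?_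
      unfold qs; rw [Finset.mul_sum]
      exact Finset.sum_congr rfl fun j _ => mul_comm _ _
    have a2 : ∑ i ∈ Λ, ∑ j ∈ Λ, jz J₁ α (j - i) * χ j = ∑ i ∈ A, qs J₁ α i Λ := by
      rw [← a1, Finset.sum_comm]
      refine Finset.sum_congr rfl fun i _ => Finset.sum_congr rfl fun j _ => ?_
      rw [jz_comm]
    have a3 : ∑ i ∈ Λ, ∑ j ∈ Λ, jz J₁ α (j - i) * (χ i * χ j) = ∑ i ∈ A, qs J₁ α i A := by
      rw [← hres]
      refine Finset.sum_congr rfl fun i _ => ?_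
      unfold qs; rw [← hres, Finset.mul_sum]
      exact Finset.sum_congr rfl fun j _ => by ring
    calc _ = 2 * (∑ i ∈ Λ, ∑ j ∈ Λ, jz J₁ α (j - i) * χ i) +
          2 * (∑ i ∈ Λ, ∑ j ∈ Λ, jz J₁ α (j - i) * χ j) -
          4 * (∑ i ∈ Λ, ∑ j ∈ Λ, jz J₁ α (j - i) * (χ i * χ j)) := by
          simp only [Finset.mul_sum, ← Finset.sum_add_distrib, ← Finset.sum_sub_distrib]
          exact Finset.sum_congr rfl fun i _ => Finset.sum_congr rfl fun j _ => by ring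
      _ = _ := by rw [a1, a2, a3]; ring
  have t3 : ∑ i : Λ, (∑' j : ℤ, if j ∈ Λ then 0 else Jcoup J₁ α ((i : ℤ) - j).natAbs)
      * (1 - 1 * spin (σ i)) = 2 * ∑ i ∈ A, (2 * tailJ J₁ α 1 - qs J₁ α i Λ) := by
    rw [← hres, Finset.mul_sum, ← Finset.sum_coe_sort Λ]
    refine Finset.sum_congr rfl fun i _ => ?_
    rw [outer_tsum J₁ α h1, hsp]; ring
  have t4 : ∑ i : Λ, h (i : ℤ) * spin (σ i) = ∑ i ∈ Λ, h i - 2 * ∑ i ∈ A, h i := by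
    rw [← hres, Finset.mul_sum, ← Finset.sum_sub_distrib, ← Finset.sum_coe_sort Λ]
    refine Finset.sum_congr rfl fun i _ => ?_
    rw [hsp]; ring
  unfold Ham
  rw [t1, t2, t3, t4]
  unfold WW
  rw [Finset.sum_sub_distrib, Finset.sum_const, nsmul_eq_mul]
  ring

/-- weight of a minus set -/
def wt (J₁ α θ β : ℝ) (ε : ℤ → ℝ) (A : Finset ℤ) : ℝ :=
  Real.exp (-(2 * β) * (WW J₁ α A + θ * ∑ x ∈ A, ε x))
/-- field with minus set `H` -/
def fs (H : Finset ℤ) (x : ℤ) : ℝ := if x ∈ H then -1 else 1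
/-- partition function -/
def ZZ (J₁ α θ β : ℝ) (Λ : Finset ℤ) (ε : ℤ → ℝ) : ℝ := ∑ A ∈ Λ.powerset, wt J₁ α θ β ε A
/-- restricted partition function -/
def ZE (J₁ α θ β : ℝ) (Λ : Finset ℤ) (ε : ℤ → ℝ) (E : Finset ℤ → Prop) : ℝ :=
  ∑ A ∈ Λ.powerset, if E A then wt J₁ α θ β ε A else 0

lemma wt_pos (J₁ α θ β : ℝ) (ε : ℤ → ℝ) (A : Finset ℤ) : 0 < wt J₁ α θ β ε A := Real.exp_pos _
lemma ZZ_pos (J₁ α θ β : ℝ) (Λ : Finset ℤ) (ε : ℤ → ℝ) : 0 < ZZ J₁ α θ β Λ ε :=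
  Finset.sum_pos (fun _ _ => wt_pos _ _ _ _ _ _) ⟨∅, by simp⟩

lemma gibbs_eq (J₁ α θ β : ℝ) (h1 : α < 1) (Λ : Finset ℤ) (h0 : (0 : ℤ) ∈ Λ) (h : ℤ → ℝ) :
    gibbs J₁ α θ 1 β Λ h (fun σ => spin (σ ⟨0, h0⟩) = -1) =
      ZE J₁ α θ β Λ h (fun A => 0 ∈ A) / ZZ J₁ α θ β Λ h := by
  unfold gibbs
  have e1 : ∀ σ : Λ → Bool, Real.exp (-β * Ham J₁ α θ 1 Λ h σ) =
      Real.exp (β * θ * ∑ i ∈ Λ, h i) * wt J₁ α θ β h (mset Λ σ) := by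
    intro σ
    rw [ham_eq _ _ _ h1, wt, ← Real.exp_add]; congr 1; ring
  have e2 : ∀ σ : Λ → Bool, (spin (σ ⟨0, h0⟩) = -1) ↔ (0 : ℤ) ∈ mset Λ σ := by
    intro σ
    have := mem_mset Λ σ ⟨0, h0⟩
    simp only at this
    rw [this]
    cases σ ⟨0, h0⟩ <;> simp [spin]
    norm_num
  have e3 : (∑ σ : Λ → Bool, if spin (σ ⟨0, h0⟩) = -1 then
      Real.exp (-β * Ham J₁ α θ 1 Λ h σ) else 0) =
      Real.exp (β * θ * ∑ i ∈ Λ, h i) * ZE J₁ α θ β Λ h (fun A => 0 ∈ A) := by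
    unfold ZE
    rw [← sum_mset Λ, Finset.mul_sum]
    refine Finset.sum_congr rfl fun σ _ => ?_
    by_cases hc : (0 : ℤ) ∈ mset Λ σ
    · rw [if_pos ((e2 σ).2 hc), if_pos hc, e1]
    · rw [if_neg (fun h => hc ((e2 σ).1 h)), if_neg hc, mul_zero]
  have e4 : (∑ σ : Λ → Bool, Real.exp (-β * Ham J₁ α θ 1 Λ h σ)) =
      Real.exp (β * θ * ∑ i ∈ Λ, h i) * ZZ J₁ α θ β Λ h := by
    unfold ZZ
    rw [← sum_mset Λ, Finset.mul_sum]
    exact Finset.sum_congr rfl fun σ _ => e1 σ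
  rw [e3, e4, mul_div_mul_left _ _ (Real.exp_ne_zero _)]

lemma fieldE_eq (Λ : Finset ℤ) (f : (ℤ → ℝ) → ℝ) :
    fieldE Λ f = (1 / 2 ^ Λ.card) * ∑ H ∈ Λ.powerset, f (fs H) := by
  unfold fieldE
  rw [← sum_mset Λ]
  congr 1
  refine Finset.sum_congr rfl fun η _ => ?_
  congr 1
  funext i
  unfold fs
  split_ifs with hi hm hm
  · have := (mem_mset Λ η ⟨i, hi⟩).1 hm
    simp [this, spin]
  · have : ¬ (η ⟨i, hi⟩ = false) := fun h => hm ((mem_mset Λ η ⟨i, hi⟩).2 h)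
    simp [spin, this]
  · exact absurd (mset_sub _ _ hm) hi
  · rfl

lemma WW_submod (J₁ α : ℝ) (hJ : 0 ≤ J₁) (A B : Finset ℤ) :
    WW J₁ α (A ∩ B) + WW J₁ α (A ∪ B) ≤ WW J₁ α A + WW J₁ α B := by
  have hq : ∀ C ⊆ A ∪ B, ∑ x ∈ C, qs J₁ α x C = ∑ x ∈ A ∪ B, ∑ y ∈ A ∪ B,
      (if x ∈ C ∧ y ∈ C then jz J₁ α (y - x) else 0) := by
    intro C hC
    rw [← Finset.sum_subset hC]
    · refine Finset.sum_congr rfl fun x hx => ?_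
      unfold qs
      rw [← Finset.sum_subset hC]
      · exact Finset.sum_congr rfl fun y hy => by simp [hx, hy]
      · intro y _ hy; simp [hy]
    · intro x _ hx
      simp [hx]
  have hcard : ((A ∩ B).card : ℝ) + (A ∪ B).card = A.card + B.card := by
    rw [add_comm]; exact_mod_cast Finset.card_union_add_card_inter A B
  have key : ∑ x ∈ A, qs J₁ α x A + ∑ x ∈ B, qs J₁ α x B ≤
      ∑ x ∈ A ∩ B, qs J₁ α x (A ∩ B) + ∑ x ∈ A ∪ B, qs J₁ α x (A ∪ B) := by
    rw [hq A Finset.subset_union_left, hq B Finset.subset_union_right, hq (A ∪ B) subset_rfl,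
      hq (A ∩ B) (Finset.inter_subset_left.trans Finset.subset_union_left)]
    simp only [← Finset.sum_add_distrib]
    refine Finset.sum_le_sum fun x _ => Finset.sum_le_sum fun y _ => ?_
    have := jz_nonneg J₁ α hJ (y - x)
    simp only [Finset.mem_inter, Finset.mem_union]
    by_cases a1 : x ∈ A <;> by_cases a2 : x ∈ B <;> by_cases a3 : y ∈ A <;>
      by_cases a4 : y ∈ B <;> simp [a1, a2, a3, a4] <;> linarith
  unfold WW
  have : 2 * tailJ J₁ α 1 * ((A ∩ B).card : ℝ) + 2 * tailJ J₁ α 1 * (A ∪ B).card =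
      2 * tailJ J₁ α 1 * A.card + 2 * tailJ J₁ α 1 * B.card := by
    rw [← mul_add, hcard, mul_add]
  linarith

lemma wt_fkg (J₁ α θ β : ℝ) (hJ : 0 ≤ J₁) (hβ : 0 ≤ β) (ε : ℤ → ℝ) (A B : Finset ℤ) :
    wt J₁ α θ β ε A * wt J₁ α θ β ε B ≤ wt J₁ α θ β ε (A ⊓ B) * wt J₁ α θ β ε (A ⊔ B) := by
  unfold wt
  rw [← Real.exp_add, ← Real.exp_add, Real.exp_le_exp]
  have h1 := WW_submod J₁ α hJ A B
  have h2 := Finset.sum_union_inter (s₁ := A) (s₂ := B) (f := ε)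
  change _ ≤ -(2 * β) * (WW J₁ α (A ∩ B) + θ * ∑ x ∈ A ∩ B, ε x) +
    -(2 * β) * (WW J₁ α (A ∪ B) + θ * ∑ x ∈ A ∪ B, ε x)
  have h3 : θ * ∑ x ∈ A ∪ B, ε x + θ * ∑ x ∈ A ∩ B, ε x = θ * ∑ x ∈ A, ε x + θ * ∑ x ∈ B, ε x := by
    rw [← mul_add, h2, mul_add]
  have h4 := mul_le_mul_of_nonneg_left h1 (show 0 ≤ 2 * β by linarith)
  have h5 := congrArg (fun z => 2 * β * z) h3
  linarith

lemma ZE_mono_vol (J₁ α θ β : ℝ) (hJ : 0 ≤ J₁) (hβ : 0 ≤ β) (ε : ℤ → ℝ) (Λ Λ' : Finset ℤ)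
    (hΛ : Λ ⊆ Λ') :
    ZE J₁ α θ β Λ ε (fun A => 0 ∈ A) / ZZ J₁ α θ β Λ ε ≤
      ZE J₁ α θ β Λ' ε (fun A => 0 ∈ A) / ZZ J₁ α θ β Λ' ε := by
  rw [div_le_div_iff₀ (ZZ_pos _ _ _ _ _ _) (ZZ_pos _ _ _ _ _ _)]
  have hfil : ∀ M : Finset ℤ, ZE J₁ α θ β M ε (fun A => 0 ∈ A) =
      ∑ A ∈ M.powerset.filter (fun A => (0 : ℤ) ∈ A), wt J₁ α θ β ε A := by
    intro M
    unfold ZE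
    rw [Finset.sum_filter]
    refine Finset.sum_congr rfl fun A _ => ?_
    by_cases h : (0 : ℤ) ∈ A <;> simp [h]
  rw [hfil, hfil, mul_comm (∑ A ∈ Λ'.powerset with _, _)]
  unfold ZZ
  have w0 : ∀ A, 0 ≤ wt J₁ α θ β ε A := fun A => (wt_pos _ _ _ _ _ _).le
  refine (four_functions_theorem _ _ _ _ w0 w0 w0 w0 (wt_fkg J₁ α θ β hJ hβ ε) _ _).trans ?_
  refine mul_le_mul ?_ ?_ (Finset.sum_nonneg fun _ _ => w0 _) (Finset.sum_nonneg fun _ _ => w0 _)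
  · refine Finset.sum_le_sum_of_subset_of_nonneg ?_ fun _ _ _ => w0 _
    intro C hC
    obtain ⟨a, ha, b, hb, rfl⟩ := Finset.mem_infs.1 hC
    simp only [Finset.mem_filter, Finset.mem_powerset] at *
    exact Finset.inter_subset_left.trans ha.1
  · refine Finset.sum_le_sum_of_subset_of_nonneg ?_ fun _ _ _ => w0 _
    intro C hC
    obtain ⟨a, ha, b, hb, rfl⟩ := Finset.mem_sups.1 hC
    simp only [Finset.mem_filter, Finset.mem_powerset] at *
    exact ⟨Finset.union_subset (ha.1.trans hΛ) hb, Finset.mem_union_left _ ha.2⟩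

lemma avg_extend (Λ U : Finset ℤ) (hd : Disjoint Λ U) (F : Finset ℤ → ℝ)
    (hF : ∀ H, F H = F (H ∩ Λ)) :
    ∑ H ∈ (Λ ∪ U).powerset, F H = 2 ^ U.card * ∑ H ∈ Λ.powerset, F H := by
  induction U using Finset.induction_on with
  | empty => simp
  | insert x U hx ih =>
    have hd' : Disjoint Λ U := Finset.disjoint_of_subset_right (Finset.subset_insert _ _) hd
    have hxΛ : x ∉ Λ := fun h => Finset.disjoint_left.1 hd h (Finset.mem_insert_self _ _)
    rw [Finset.union_insert, Finset.sum_powerset_insert (by simp [hx, hxΛ])]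
    have : ∑ t ∈ (Λ ∪ U).powerset, F (insert x t) = ∑ t ∈ (Λ ∪ U).powerset, F t := by
      refine Finset.sum_congr rfl fun t _ => ?_
      rw [hF, hF t, Finset.insert_inter_of_notMem hxΛ]
    rw [this, ih hd', Finset.card_insert_of_notMem hx]
    ring

lemma wt_congr (J₁ α θ β : ℝ) (Λ H A : Finset ℤ) (hA : A ⊆ Λ) :
    wt J₁ α θ β (fs H) A = wt J₁ α θ β (fs (H ∩ Λ)) A := by
  unfold wt
  congr 4
  refine Finset.sum_congr rfl fun x hx => ?_
  simp [fs, hA hx]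

/-- reduction to a larger volume -/
lemma to_big (J₁ α θ β : ℝ) (h1 : α < 1) (hJ : 0 ≤ J₁) (hβ : 0 ≤ β) (Λ Λ' : Finset ℤ)
    (hΛ : Λ ⊆ Λ') (h0 : (0 : ℤ) ∈ Λ) :
    fieldE Λ (fun h => gibbs J₁ α θ 1 β Λ h (fun σ => spin (σ ⟨0, h0⟩) = -1)) ≤
      (1 / 2 ^ Λ'.card) * ∑ H ∈ Λ'.powerset,
        ZE J₁ α θ β Λ' (fs H) (fun A => 0 ∈ A) / ZZ J₁ α θ β Λ' (fs H) := by
  rw [fieldE_eq]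
  simp only [gibbs_eq J₁ α θ β h1]
  have hu : Λ ∪ (Λ' \ Λ) = Λ' := Finset.union_sdiff_of_subset hΛ
  have := avg_extend Λ (Λ' \ Λ) Finset.disjoint_sdiff
    (fun H => ZE J₁ α θ β Λ (fs H) (fun A => 0 ∈ A) / ZZ J₁ α θ β Λ (fs H)) (by
      intro H
      have a1 : ZE J₁ α θ β Λ (fs H) (fun A => 0 ∈ A) =
          ZE J₁ α θ β Λ (fs (H ∩ Λ)) (fun A => 0 ∈ A) := by
        unfold ZE
        refine Finset.sum_congr rfl fun A hA => ?_
        rw [wt_congr J₁ α θ β Λ H A (Finset.mem_powerset.1 hA)]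
      have a2 : ZZ J₁ α θ β Λ (fs H) = ZZ J₁ α θ β Λ (fs (H ∩ Λ)) := by
        unfold ZZ
        refine Finset.sum_congr rfl fun A hA => ?_
        rw [wt_congr J₁ α θ β Λ H A (Finset.mem_powerset.1 hA)]
      simp only [a1, a2])
  rw [hu] at this
  have hc : Λ'.card = Λ.card + (Λ' \ Λ).card := by
    rw [← Finset.card_union_of_disjoint Finset.disjoint_sdiff, hu]
  calc _ = (1 / 2 ^ Λ'.card) * (2 ^ (Λ' \ Λ).card * ∑ H ∈ Λ.powerset,
        ZE J₁ α θ β Λ (fs H) (fun A => 0 ∈ A) / ZZ J₁ α θ β Λ (fs H)) := by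
        rw [hc, pow_add]; field_simp
    _ ≤ _ := by
        rw [← this]
        refine mul_le_mul_of_nonneg_left (Finset.sum_le_sum fun H _ => ?_) (by positivity)
        exact ZE_mono_vol J₁ α θ β hJ hβ _ Λ Λ' hΛ


lemma fs_sq (H : Finset ℤ) (x : ℤ) : fs H x = 1 ∨ fs H x = -1 := by
  unfold fs; split_ifs <;> simp

lemma fs_symm_mem (H I : Finset ℤ) (x : ℤ) (hx : x ∈ I) : fs (symmDiff H I) x = - fs H x := by
  unfold fs
  by_cases h : x ∈ H <;> simp [Finset.mem_symmDiff, h, hx]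

lemma fs_symm_notMem (H I : Finset ℤ) (x : ℤ) (hx : x ∉ I) : fs (symmDiff H I) x = fs H x := by
  unfold fs
  by_cases h : x ∈ H <;> simp [Finset.mem_symmDiff, h, hx]

lemma fs_sum_single (H A : Finset ℤ) (x : ℤ) :
    ∑ y ∈ A, fs (symmDiff H {x}) y = ∑ y ∈ A, fs H y - 2 * fs H x * (if x ∈ A then 1 else 0) := by
  by_cases hx : x ∈ A
  · rw [← Finset.add_sum_erase _ _ hx, ← Finset.add_sum_erase A (fs H) hx,
      fs_symm_mem _ _ _ (Finset.mem_singleton_self x)]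
    have : ∑ y ∈ A.erase x, fs (symmDiff H {x}) y = ∑ y ∈ A.erase x, fs H y :=
      Finset.sum_congr rfl fun y hy => fs_symm_notMem _ _ _ (by
        simpa using (Finset.mem_erase.1 hy).1)
    rw [this, if_pos hx]; ring
  · rw [if_neg hx]
    have : ∑ y ∈ A, fs (symmDiff H {x}) y = ∑ y ∈ A, fs H y :=
      Finset.sum_congr rfl fun y hy => fs_symm_notMem _ _ _ (by
        simp only [Finset.mem_singleton]; rintro rfl; exact hx hy)
    rw [this]; ring

lemma logZ_osc (J₁ α θ β : ℝ) (hθ : 0 ≤ θ) (hβ : 0 ≤ β) (Λ H : Finset ℤ) (x : ℤ) :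
    |Real.log (ZZ J₁ α θ β Λ (fs (symmDiff H {x}))) - Real.log (ZZ J₁ α θ β Λ (fs H))
      - 2 * β * θ * fs H x| ≤ 2 * β * θ := by
  have hb : 0 ≤ β * θ := by positivity
  have z1 := ZZ_pos J₁ α θ β Λ (fs H)
  have z2 := ZZ_pos J₁ α θ β Λ (fs (symmDiff H {x}))
  have lo : Real.exp (2 * β * θ * fs H x - 2 * β * θ) * ZZ J₁ α θ β Λ (fs H) ≤
      ZZ J₁ α θ β Λ (fs (symmDiff H {x})) := by
    unfold ZZ
    rw [Finset.mul_sum]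
    refine Finset.sum_le_sum fun A _ => ?_
    unfold wt
    rw [← Real.exp_add, Real.exp_le_exp, fs_sum_single]
    rcases fs_sq H x with h | h <;> rw [h] <;> split_ifs <;> nlinarith
  have hi : ZZ J₁ α θ β Λ (fs (symmDiff H {x})) ≤
      Real.exp (2 * β * θ * fs H x + 2 * β * θ) * ZZ J₁ α θ β Λ (fs H) := by
    unfold ZZ
    rw [Finset.mul_sum]
    refine Finset.sum_le_sum fun A _ => ?_
    unfold wt
    rw [← Real.exp_add, Real.exp_le_exp, fs_sum_single]
    rcases fs_sq H x with h | h <;> rw [h] <;> split_ifs <;> nlinarith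
  have lo' := Real.log_le_log (by positivity) lo
  have hi' := Real.log_le_log z2 hi
  rw [Real.log_mul (Real.exp_ne_zero _) z1.ne', Real.log_exp] at lo' hi'
  rw [abs_le]
  constructor <;> linarith

/-- the log ratio -/
def ff (J₁ α θ β : ℝ) (Λ I H : Finset ℤ) : ℝ :=
  Real.log (ZZ J₁ α θ β Λ (fs (symmDiff H I))) - Real.log (ZZ J₁ α θ β Λ (fs H))
    - 2 * β * θ * ∑ x ∈ I, fs H x

lemma ff_osc (J₁ α θ β : ℝ) (hθ : 0 ≤ θ) (hβ : 0 ≤ β) (Λ I H : Finset ℤ) (x : ℤ) (hx : x ∈ I) :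
    |ff J₁ α θ β Λ I (symmDiff H {x}) - ff J₁ α θ β Λ I H| ≤ 4 * β * θ := by
  have h1 := logZ_osc J₁ α θ β hθ hβ Λ H x
  have h2 := logZ_osc J₁ α θ β hθ hβ Λ (symmDiff H I) x
  rw [fs_symm_mem _ _ _ hx] at h2
  unfold ff
  rw [show symmDiff (symmDiff H {x}) I = symmDiff (symmDiff H I) {x} from
    symmDiff_right_comm _ _ _, fs_sum_single, if_pos hx]
  rw [abs_le] at *
  constructor <;> linarith [h1.1, h1.2, h2.1, h2.2]

lemma ff_anti (J₁ α θ β : ℝ) (Λ I H : Finset ℤ) :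
    ff J₁ α θ β Λ I (symmDiff H I) = - ff J₁ α θ β Λ I H := by
  unfold ff
  rw [symmDiff_symmDiff_cancel_right]
  have : ∑ x ∈ I, fs (symmDiff H I) x = - ∑ x ∈ I, fs H x := by
    rw [← Finset.sum_neg_distrib]
    exact Finset.sum_congr rfl fun x hx => fs_symm_mem _ _ _ hx
  rw [this]; ring

lemma two_exp (a b c : ℝ) (h : |b - a| ≤ 2 * c) :
    Real.exp a + Real.exp b ≤ 2 * Real.exp ((a + b) / 2 + c ^ 2 / 2) := by
  have h1 : Real.exp a + Real.exp b = 2 * Real.exp ((a + b) / 2) * Real.cosh ((b - a) / 2) := by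
    rw [Real.cosh_eq]
    have e1 : Real.exp a = Real.exp ((a + b) / 2) * Real.exp (-((b - a) / 2)) := by
      rw [← Real.exp_add]; congr 1; ring
    have e2 : Real.exp b = Real.exp ((a + b) / 2) * Real.exp ((b - a) / 2) := by
      rw [← Real.exp_add]; congr 1; ring
    rw [e1, e2]; ring
  rw [h1, Real.exp_add, ← mul_assoc]
  refine mul_le_mul_of_nonneg_left ?_ (by positivity)
  refine (Real.cosh_le_exp_half_sq _).trans ?_
  rw [Real.exp_le_exp]
  have : ((b - a) / 2) ^ 2 ≤ c ^ 2 := by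
    apply sq_le_sq'
    · rw [abs_le] at h; linarith [h.1]
    · rw [abs_le] at h; linarith [h.2]
  linarith

lemma mcd (S : Finset ℤ) (c : ℝ) : ∀ f : Finset ℤ → ℝ,
    (∀ x ∈ S, ∀ H, |f (symmDiff H {x}) - f H| ≤ 2 * c) →
    ∑ T ∈ S.powerset, Real.exp (f T) ≤
      2 ^ S.card * Real.exp ((∑ T ∈ S.powerset, f T) / 2 ^ S.card + S.card * (c ^ 2 / 2)) := by
  induction S using Finset.induction_on with
  | empty => intro f _; simp
  | insert x S hx ih =>
    intro f hf
    have hins : ∀ T ∈ S.powerset, insert x T = symmDiff T {x} := by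
      intro T hT
      have : x ∉ T := fun h => hx (Finset.mem_powerset.1 hT h)
      ext y
      simp only [Finset.mem_insert, Finset.mem_symmDiff, Finset.mem_singleton]
      by_cases hy : y = x
      · subst hy; simp [this]
      · simp [hy]
    have hg := ih (fun T => (f T + f (symmDiff T {x})) / 2) (by
      intro y hy H
      have a1 := hf y (Finset.mem_insert_of_mem hy) H
      have a2 := hf y (Finset.mem_insert_of_mem hy) (symmDiff H {x})
      rw [symmDiff_right_comm] at a2
      rw [abs_le] at *
      constructor <;> linarith [a1.1, a1.2, a2.1, a2.2])
    rw [Finset.sum_powerset_insert hx, Finset.sum_powerset_insert hx,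
      Finset.card_insert_of_notMem hx, ← Finset.sum_add_distrib, ← Finset.sum_add_distrib]
    have s1 : ∑ T ∈ S.powerset, (Real.exp (f T) + Real.exp (f (insert x T))) ≤
        ∑ T ∈ S.powerset, 2 * Real.exp (c ^ 2 / 2) *
          Real.exp ((f T + f (symmDiff T {x})) / 2) := by
      refine Finset.sum_le_sum fun T hT => ?_
      rw [hins T hT]
      refine (two_exp _ _ c (hf x (Finset.mem_insert_self _ _) T)).trans (le_of_eq ?_)
      rw [Real.exp_add]; ring
    refine s1.trans ?_
    rw [← Finset.mul_sum]
    refine (mul_le_mul_of_nonneg_left hg (by positivity)).trans (le_of_eq ?_)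
    have s2 : ∑ T ∈ S.powerset, (f T + f (insert x T)) =
        2 * ∑ T ∈ S.powerset, (f T + f (symmDiff T {x})) / 2 := by
      rw [Finset.mul_sum]
      refine Finset.sum_congr rfl fun T hT => ?_
      rw [hins T hT]; ring
    rw [s2, pow_succ (2 : ℝ) S.card]
    have s3 : 2 * (∑ T ∈ S.powerset, (f T + f (symmDiff T {x})) / 2) / (2 ^ S.card * 2) =
        (∑ T ∈ S.powerset, (f T + f (symmDiff T {x})) / 2) / 2 ^ S.card := by field_simp
    rw [s3]
    push_cast
    rw [show ∀ X : ℝ, X + ((S.card : ℝ) + 1) * (c ^ 2 / 2) =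
      c ^ 2 / 2 + (X + S.card * (c ^ 2 / 2)) by intro X; ring, Real.exp_add (c ^ 2 / 2)]
    ring

lemma sum_symm (Λ T : Finset ℤ) (hT : T ⊆ Λ) (F : Finset ℤ → ℝ) :
    ∑ H ∈ Λ.powerset, F (symmDiff H T) = ∑ H ∈ Λ.powerset, F H := by
  have hm : ∀ H ∈ Λ.powerset, symmDiff H T ∈ Λ.powerset := by
    intro H hH
    rw [Finset.mem_powerset] at *
    intro x hx
    rcases Finset.mem_symmDiff.1 hx with h | h
    · exact hH h.1
    · exact hT h.1
  refine Finset.sum_bij' (fun H _ => symmDiff H T) (fun H _ => symmDiff H T) hm hm ?_ ?_ ?_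
  · intro H _; exact symmDiff_symmDiff_cancel_right _ _
  · intro H _; exact symmDiff_symmDiff_cancel_right _ _
  · intro H _; rfl

/-- exponential moment -/
lemma exp_moment (J₁ α θ β u : ℝ) (hθ : 0 ≤ θ) (hβ : 0 ≤ β) (hu : 0 ≤ u) (Λ I : Finset ℤ)
    (hI : I ⊆ Λ) :
    ∑ H ∈ Λ.powerset, Real.exp (u * ff J₁ α θ β Λ I H) ≤
      2 ^ Λ.card * Real.exp (2 * u ^ 2 * β ^ 2 * θ ^ 2 * I.card) := by
  set f := ff J₁ α θ β Λ I with hf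
  have h1 : ∑ H ∈ Λ.powerset, ∑ T ∈ I.powerset, Real.exp (u * f (symmDiff H T)) =
      2 ^ I.card * ∑ H ∈ Λ.powerset, Real.exp (u * f H) := by
    rw [Finset.sum_comm]
    rw [Finset.sum_congr rfl fun T hT => sum_symm Λ T ((Finset.mem_powerset.1 hT).trans hI)
      (fun H => Real.exp (u * f H))]
    rw [Finset.sum_const, Finset.card_powerset, nsmul_eq_mul]
    push_cast; ring
  have h2 : ∀ H ∈ Λ.powerset, ∑ T ∈ I.powerset, Real.exp (u * f (symmDiff H T)) ≤
      2 ^ I.card * Real.exp (2 * u ^ 2 * β ^ 2 * θ ^ 2 * I.card) := by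
    intro H _
    have := mcd I (u * (2 * β * θ)) (fun T => u * f (symmDiff H T)) (by
      intro x hx T
      rw [← symmDiff_assoc, ← mul_sub, abs_mul, abs_of_nonneg hu]
      have := ff_osc J₁ α θ β hθ hβ Λ I (symmDiff H T) x hx
      have := mul_le_mul_of_nonneg_left this hu
      rw [hf]
      linarith)
    refine this.trans (le_of_eq ?_)
    have h0 : ∑ T ∈ I.powerset, u * f (symmDiff H T) = 0 := by
      have e := sum_symm I I subset_rfl (fun T => u * f (symmDiff H T))
      have e2 : ∑ T ∈ I.powerset, u * f (symmDiff H (symmDiff T I)) =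
          - ∑ T ∈ I.powerset, u * f (symmDiff H T) := by
        rw [← Finset.sum_neg_distrib]
        refine Finset.sum_congr rfl fun T _ => ?_
        rw [← symmDiff_assoc, hf, ff_anti]; ring
      linarith
    rw [h0]
    congr 2; ring
  have h3 := Finset.sum_le_sum h2
  rw [h1, Finset.sum_const, Finset.card_powerset, nsmul_eq_mul] at h3
  push_cast at h3
  have h4 : (0 : ℝ) < 2 ^ I.card := by positivity
  rw [mul_left_comm] at h3
  exact le_of_mul_le_mul_left h3 h4

lemma ZE_le_ZZ (J₁ α θ β : ℝ) (Λ : Finset ℤ) (ε : ℤ → ℝ) (E : Finset ℤ → Prop) :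
    ZE J₁ α θ β Λ ε E ≤ ZZ J₁ α θ β Λ ε := by
  refine Finset.sum_le_sum fun A _ => ?_
  split_ifs
  · rfl
  · exact (wt_pos _ _ _ _ _ _).le

lemma fs_sum_flip (H A I : Finset ℤ) :
    ∑ x ∈ A, fs H x - ∑ x ∈ symmDiff A I, fs (symmDiff H I) x = ∑ x ∈ I, fs H x := by
  have e1 : ∑ x ∈ A, fs H x = ∑ x ∈ A \ I, fs H x + ∑ x ∈ A ∩ I, fs H x := by
    rw [add_comm]; exact (Finset.sum_inter_add_sum_sdiff A I _).symm
  have e2 : ∑ x ∈ I, fs H x = ∑ x ∈ I \ A, fs H x + ∑ x ∈ A ∩ I, fs H x := by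
    rw [add_comm, Finset.inter_comm]; exact (Finset.sum_inter_add_sum_sdiff I A _).symm
  have e3 : symmDiff A I = (A \ I) ∪ (I \ A) := rfl
  have e4 : Disjoint (A \ I) (I \ A) := by
    rw [Finset.disjoint_left]; intro x hx hy
    simp only [Finset.mem_sdiff] at hx hy; exact hy.2 hx.1
  rw [e1, e2, e3, Finset.sum_union e4]
  have e5 : ∑ x ∈ A \ I, fs (symmDiff H I) x = ∑ x ∈ A \ I, fs H x :=
    Finset.sum_congr rfl fun x hx => fs_symm_notMem _ _ _ (Finset.mem_sdiff.1 hx).2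
  have e6 : ∑ x ∈ I \ A, fs (symmDiff H I) x = - ∑ x ∈ I \ A, fs H x := by
    rw [← Finset.sum_neg_distrib]
    exact Finset.sum_congr rfl fun x hx => fs_symm_mem _ _ _ (Finset.mem_sdiff.1 hx).1
  rw [e5, e6]; ring

lemma quenched (J₁ α θ β g : ℝ) (hβ : 0 ≤ β) (Λ I H : Finset ℤ) (hI : I ⊆ Λ) :
    ZE J₁ α θ β Λ (fs H) (fun A => g ≤ WW J₁ α A - WW J₁ α (symmDiff A I)) /
      ZZ J₁ α θ β Λ (fs H) ≤ Real.exp (ff J₁ α θ β Λ I H - 2 * β * g) := by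
  have z1 := ZZ_pos J₁ α θ β Λ (fs H)
  have z2 := ZZ_pos J₁ α θ β Λ (fs (symmDiff H I))
  rw [div_le_iff₀ z1]
  have : Real.exp (ff J₁ α θ β Λ I H - 2 * β * g) * ZZ J₁ α θ β Λ (fs H) =
      Real.exp (- 2 * β * g - 2 * β * θ * ∑ x ∈ I, fs H x) *
        ZZ J₁ α θ β Λ (fs (symmDiff H I)) := by
    conv_lhs => rw [← Real.exp_log z1]
    conv_rhs => rw [← Real.exp_log z2]
    rw [← Real.exp_add, ← Real.exp_add]
    congr 1
    unfold ff
    ring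
  rw [this]
  have e := sum_symm Λ I hI (wt J₁ α θ β (fs (symmDiff H I)))
  unfold ZZ ZE
  rw [← e, Finset.mul_sum]
  refine Finset.sum_le_sum fun A _ => ?_
  split_ifs with hA
  · unfold wt
    rw [← Real.exp_add, Real.exp_le_exp, ← fs_sum_flip H A I]
    have := mul_le_mul_of_nonneg_left hA (show 0 ≤ 2 * β by linarith)
    linarith
  · have := wt_pos J₁ α θ β (fs (symmDiff H I)) (symmDiff A I)
    positivity

lemma annealed_u (J₁ α θ β g u : ℝ) (hθ : 0 ≤ θ) (hβ : 0 ≤ β) (hu : 0 ≤ u) (hu1 : u ≤ 1)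
    (Λ I : Finset ℤ) (hI : I ⊆ Λ) :
    ∑ H ∈ Λ.powerset, ZE J₁ α θ β Λ (fs H) (fun A => g ≤ WW J₁ α A - WW J₁ α (symmDiff A I)) /
      ZZ J₁ α θ β Λ (fs H) ≤
    2 ^ Λ.card * Real.exp (2 * u ^ 2 * β ^ 2 * θ ^ 2 * I.card - 2 * u * β * g) := by
  have h1 : ∀ H ∈ Λ.powerset,
      ZE J₁ α θ β Λ (fs H) (fun A => g ≤ WW J₁ α A - WW J₁ α (symmDiff A I)) /
      ZZ J₁ α θ β Λ (fs H) ≤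
      Real.exp (u * ff J₁ α θ β Λ I H) * Real.exp (-(2 * u * β * g)) := by
    intro H _
    rw [← Real.exp_add]
    have a1 := quenched J₁ α θ β g hβ Λ I H hI
    have a2 : ZE J₁ α θ β Λ (fs H) (fun A => g ≤ WW J₁ α A - WW J₁ α (symmDiff A I)) /
      ZZ J₁ α θ β Λ (fs H) ≤ 1 := (div_le_one (ZZ_pos _ _ _ _ _ _)).2 (ZE_le_ZZ _ _ _ _ _ _ _)
    have e : u * ff J₁ α θ β Λ I H + -(2 * u * β * g) =
      u * (ff J₁ α θ β Λ I H - 2 * β * g) := by ring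
    rw [e]
    set y := ff J₁ α θ β Λ I H - 2 * β * g with hy
    by_cases h : 0 ≤ y
    · refine a2.trans (Real.one_le_exp (by positivity))
    · refine a1.trans ?_
      rw [Real.exp_le_exp]
      nlinarith
  refine (Finset.sum_le_sum h1).trans ?_
  rw [← Finset.sum_mul]
  refine (mul_le_mul_of_nonneg_right (exp_moment J₁ α θ β u hθ hβ hu Λ I hI)
    (Real.exp_pos _).le).trans (le_of_eq ?_)
  rw [mul_assoc, ← Real.exp_add]; congr 2

lemma annealed_event (J₁ α θ β g D : ℝ) (hθ : 0 < θ) (hβ : 0 < β) (hD : 0 ≤ D)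
    (Λ I : Finset ℤ) (hI : I ⊆ Λ) (hg1 : D ≤ g) (hg2 : D * I.card ≤ g ^ 2) :
    ∑ H ∈ Λ.powerset, ZE J₁ α θ β Λ (fs H) (fun A => g ≤ WW J₁ α A - WW J₁ α (symmDiff A I)) /
      ZZ J₁ α θ β Λ (fs H) ≤
    2 ^ Λ.card * Real.exp (-(min β (1 / (2 * θ ^ 2)) * D)) := by
  have hg0 : 0 ≤ g := hD.trans hg1
  set n : ℝ := (I.card : ℝ) with hn
  have hn0 : 0 ≤ n := Nat.cast_nonneg _
  by_cases hc : 2 * β * θ ^ 2 * n ≤ g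
  · refine (annealed_u J₁ α θ β g 1 hθ.le hβ.le zero_le_one le_rfl Λ I hI).trans ?_
    gcongr
    have a1 : min β (1 / (2 * θ ^ 2)) * D ≤ β * g :=
      mul_le_mul (min_le_left _ _) hg1 hD hβ.le
    have a2 := mul_le_mul_of_nonneg_left hc hβ.le
    nlinarith
  · push Not at hc
    have hnp : 0 < n := by
      rcases hn0.lt_or_eq with h | h
      · exact h
      · rw [← h] at hc; simp at hc; linarith
    have hd : 0 < 2 * β * θ ^ 2 * n := by positivity
    refine (annealed_u J₁ α θ β g (g / (2 * β * θ ^ 2 * n)) hθ.le hβ.le (by positivity)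
      ((div_le_one hd).2 hc.le) Λ I hI).trans ?_
    gcongr
    rw [← hn]
    have e : 2 * (g / (2 * β * θ ^ 2 * n)) ^ 2 * β ^ 2 * θ ^ 2 * n -
        2 * (g / (2 * β * θ ^ 2 * n)) * β * g = -(1 / (2 * θ ^ 2) * (g ^ 2 / n)) := by
      field_simp; ring
    rw [e, neg_le_neg_iff]
    refine mul_le_mul (min_le_right _ _) ?_ hD (by positivity)
    rw [le_div_iff₀ hnp]; exact hg2


lemma exp_stepc_le (s : ℤ) : Real.exp (-(4 * stepc s)) ≤ (1 / 16) * (1 / (1 + |(s : ℝ)|) ^ 2) := by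
  have hy : (1 : ℝ) ≤ 1 + |(s : ℝ)| := by linarith [abs_nonneg (s : ℝ)]
  unfold stepc
  set y := 1 + |(s : ℝ)|
  have hl : 0 ≤ Real.log y := Real.log_nonneg hy
  have e : Real.exp (-(2 * Real.log y)) = 1 / y ^ 2 := by
    rw [Real.exp_neg, two_mul, Real.exp_add, Real.exp_log (by linarith), one_div, sq]
  have e4 : Real.exp (-4) ≤ 1 / 16 := by
    rw [Real.exp_neg, one_div]
    apply inv_anti₀ (by norm_num)
    have h1 : (2 : ℝ) ≤ Real.exp 1 := by have := Real.add_one_le_exp (1 : ℝ); linarith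
    have h2 : Real.exp 4 = Real.exp 1 ^ 4 := by rw [← Real.exp_nat_mul]; norm_num
    rw [h2]
    calc (16 : ℝ) = 2 ^ 4 := by norm_num
      _ ≤ _ := by gcongr
  calc Real.exp (-(4 * (1 + Real.log y))) ≤ Real.exp (-4 + -(2 * Real.log y)) := by
        rw [Real.exp_le_exp]; linarith
    _ = Real.exp (-4) * (1 / y ^ 2) := by rw [Real.exp_add, e]
    _ ≤ _ := by gcongr

lemma sum_inv_sq (M : ℕ) :
    ∑ s ∈ Finset.Icc (-(M : ℤ)) M, 1 / (1 + |(s : ℝ)|) ^ 2 ≤ 3 - 2 / ((M : ℝ) + 1) := by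
  induction M with
  | zero => norm_num
  | succ M ih =>
    have : Finset.Icc (-((M + 1 : ℕ) : ℤ)) ((M + 1 : ℕ) : ℤ) =
        insert (-((M : ℤ) + 1)) (insert ((M : ℤ) + 1) (Finset.Icc (-(M : ℤ)) M)) := by
      ext x; simp only [Finset.mem_Icc, Finset.mem_insert]; push_cast; omega
    rw [this, Finset.sum_insert (by simp; omega), Finset.sum_insert (by simp)]
    push_cast
    have hM : (0 : ℝ) ≤ M := Nat.cast_nonneg _
    rw [abs_neg, abs_of_nonneg (show (0 : ℝ) ≤ M + 1 by linarith)]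
    have key : 2 * (1 / (1 + ((M : ℝ) + 1)) ^ 2) ≤ 2 / ((M : ℝ) + 1) - 2 / ((M : ℝ) + 1 + 1) := by
      rw [div_sub_div _ _ (by positivity) (by positivity), mul_one_div,
        div_le_div_iff₀ (by positivity) (by positivity)]
      nlinarith
    linarith

lemma sum_heads (F : Finset (ℤ × Bool)) : ∑ s ∈ F, Real.exp (-(4 * stepc s.1)) ≤ 1 / 2 := by
  set M : ℕ := ∑ s ∈ F, s.1.natAbs with hM
  have hsub : F ⊆ Finset.Icc (-(M : ℤ)) M ×ˢ (Finset.univ : Finset Bool) := by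
    intro s hs
    have : s.1.natAbs ≤ M :=
      Finset.single_le_sum (f := fun s : ℤ × Bool => s.1.natAbs) (fun _ _ => Nat.zero_le _) hs
    simp only [Finset.mem_product, Finset.mem_Icc, Finset.mem_univ, and_true]
    omega
  refine (Finset.sum_le_sum_of_subset_of_nonneg hsub fun _ _ _ => (Real.exp_pos _).le).trans ?_
  rw [Finset.sum_product]
  simp only [Finset.sum_const, Finset.card_univ, Fintype.card_bool, nsmul_eq_mul]
  have h1 : ∑ x ∈ Finset.Icc (-(M : ℤ)) M, ((2 : ℕ) : ℝ) * Real.exp (-(4 * stepc x)) ≤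
      ∑ x ∈ Finset.Icc (-(M : ℤ)) M, (1 / 8) * (1 / (1 + |(x : ℝ)|) ^ 2) := by
    refine Finset.sum_le_sum fun x _ => ?_
    have := exp_stepc_le x
    push_cast; linarith
  refine h1.trans ?_
  rw [← Finset.mul_sum]
  have h2 := sum_inv_sq M
  have h3 : 0 ≤ 2 / ((M : ℝ) + 1) := by positivity
  linarith

/-- list weight -/
def vl (l : List (ℤ × Bool)) : ℝ := Real.exp (-(4 * mcost l))

lemma vl_cons (s : ℤ × Bool) (l : List (ℤ × Bool)) :
    vl (s :: l) = Real.exp (-(4 * stepc s.1)) * vl l := by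
  unfold vl
  rw [← Real.exp_add]; congr 1; simp [mcost]; ring

lemma vl_nonneg (l : List (ℤ × Bool)) : 0 ≤ vl l := (Real.exp_pos _).le

lemma lists_cons (S : Finset (List (ℤ × Bool))) (hne : ∀ l ∈ S, l ≠ [])
    (ht : ∑ l ∈ S.image List.tail, vl l ≤ 2) : ∑ l ∈ S, vl l ≤ 1 := by
  set Hd := S.image (fun l => l.headD default) with hHd
  set Tl := S.image List.tail with hTl
  have hsub : S ⊆ (Hd ×ˢ Tl).image (fun p => p.1 :: p.2) := by
    intro l hl
    rw [Finset.mem_image]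
    refine ⟨(l.headD default, l.tail), ?_, ?_⟩
    · rw [Finset.mem_product]
      exact ⟨Finset.mem_image_of_mem _ hl, Finset.mem_image_of_mem _ hl⟩
    · cases l with
      | nil => exact absurd rfl (hne _ hl)
      | cons a l => rfl
  refine (Finset.sum_le_sum_of_subset_of_nonneg hsub fun _ _ _ => vl_nonneg _).trans ?_
  rw [Finset.sum_image (by
    rintro ⟨a, b⟩ _ ⟨c, d⟩ _ h
    simpa using h)]
  rw [Finset.sum_product]
  have h1 : ∑ x ∈ Hd, ∑ y ∈ Tl, vl (x :: y) =
      (∑ x ∈ Hd, Real.exp (-(4 * stepc x.1))) * ∑ y ∈ Tl, vl y := by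
    rw [Finset.sum_mul_sum]
    exact Finset.sum_congr rfl fun x _ => Finset.sum_congr rfl fun y _ => vl_cons x y
  rw [h1]
  have h2 := sum_heads Hd
  have h3 : 0 ≤ ∑ x ∈ Hd, Real.exp (-(4 * stepc x.1)) :=
    Finset.sum_nonneg fun _ _ => (Real.exp_pos _).le
  have h4 : 0 ≤ ∑ y ∈ Tl, vl y := Finset.sum_nonneg fun _ _ => vl_nonneg _
  nlinarith

lemma lists_le (n : ℕ) : ∀ S : Finset (List (ℤ × Bool)), (∀ l ∈ S, l.length ≤ n) →
    ∑ l ∈ S, vl l ≤ 2 := by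
  have hnil : vl [] = 1 := by simp [vl, mcost]
  induction n with
  | zero =>
    intro S hS
    have : S ⊆ {[]} := by
      intro l hl
      have := hS l hl
      simp at this
      simp [this]
    refine (Finset.sum_le_sum_of_subset_of_nonneg this fun _ _ _ => vl_nonneg _).trans ?_
    rw [Finset.sum_singleton, hnil]; norm_num
  | succ n ih =>
    intro S hS
    have hsub : S ⊆ insert [] (S.erase []) := by
      intro l hl
      by_cases h : l = []
      · simp [h]
      · simp [h, hl]
    refine (Finset.sum_le_sum_of_subset_of_nonneg hsub fun _ _ _ => vl_nonneg _).trans ?_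
    rw [Finset.sum_insert (by simp), hnil]
    have := lists_cons (S.erase []) (fun l hl => (Finset.mem_erase.1 hl).1) (ih _ (by
      intro l hl
      obtain ⟨m, hm, rfl⟩ := Finset.mem_image.1 hl
      have := hS m (Finset.mem_erase.1 hm).2
      simp; omega))
    linarith

lemma lists_sum (S : Finset (List (ℤ × Bool))) (hne : ∀ l ∈ S, l ≠ []) : ∑ l ∈ S, vl l ≤ 1 := by
  apply lists_cons S hne
  apply lists_le (∑ l ∈ S.image List.tail, l.length)
  intro l hl
  exact Finset.single_le_sum (f := fun l : List (ℤ × Bool) => l.length)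
    (fun _ _ => Nat.zero_le _) hl

lemma mcost_ge (l : List (ℤ × Bool)) (hl : l ≠ []) : 1 ≤ mcost l := by
  cases l with
  | nil => exact absurd rfl hl
  | cons a l =>
    have : 0 ≤ (l.map fun s => stepc s.1).sum := by
      apply List.sum_nonneg
      intro x hx
      obtain ⟨y, _, rfl⟩ := List.mem_map.1 hx
      linarith [stepc_ge y.1]
    have h2 := stepc_ge a.1
    simp only [mcost, List.map_cons, List.sum_cons]
    linarith

lemma interval_bound (J₁ α θ β : ℝ) (hθ : 0 < θ) (hθ2 : θ ≤ 1 / 2) (hβ : 1 ≤ β) (N : ℕ)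
    (hdet : ∀ A : Finset ℤ, A ⊆ Finset.Icc (-(N : ℤ)) N → (0 : ℤ) ∈ A →
      ∃ l : List (ℤ × Bool), l ≠ [] ∧
        8 * mcost l ≤ WW J₁ α A - WW J₁ α (symmDiff A (IS N l)) ∧
        8 * mcost l * (IS N l).card ≤ (WW J₁ α A - WW J₁ α (symmDiff A (IS N l))) ^ 2) :
    (1 / 2 ^ (Finset.Icc (-(N : ℤ)) N).card) * ∑ H ∈ (Finset.Icc (-(N : ℤ)) N).powerset,
        ZE J₁ α θ β (Finset.Icc (-(N : ℤ)) N) (fs H) (fun A => 0 ∈ A) /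
          ZZ J₁ α θ β (Finset.Icc (-(N : ℤ)) N) (fs H) ≤
      Real.exp (-(4 * min β (1 / (2 * θ ^ 2)))) := by
  set Λ := Finset.Icc (-(N : ℤ)) N with hΛ
  set B := min β (1 / (2 * θ ^ 2)) with hB
  have hB1 : 1 ≤ B := by
    apply le_min hβ
    rw [le_div_iff₀ (by positivity)]
    nlinarith
  have hch : ∀ A : Finset ℤ, ∃ l : List (ℤ × Bool), A ⊆ Λ → (0 : ℤ) ∈ A → l ≠ [] ∧
        8 * mcost l ≤ WW J₁ α A - WW J₁ α (symmDiff A (IS N l)) ∧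
        8 * mcost l * (IS N l).card ≤ (WW J₁ α A - WW J₁ α (symmDiff A (IS N l))) ^ 2 := by
    intro A
    by_cases h : A ⊆ Λ ∧ (0 : ℤ) ∈ A
    · obtain ⟨l, hl⟩ := hdet A h.1 h.2
      exact ⟨l, fun _ _ => hl⟩
    · exact ⟨[], fun h1 h2 => absurd ⟨h1, h2⟩ h⟩
  choose L hL using hch
  set S := (Λ.powerset.filter (fun A => (0 : ℤ) ∈ A)).image L with hS
  have hSne : ∀ l ∈ S, l ≠ [] := by
    intro l hl
    obtain ⟨A, hA, rfl⟩ := Finset.mem_image.1 hl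
    rw [Finset.mem_filter, Finset.mem_powerset] at hA
    exact (hL A hA.1 hA.2).1
  set g : List (ℤ × Bool) → ℝ := fun l =>
    max (8 * mcost l) (Real.sqrt (8 * mcost l * (IS N l).card)) with hg
  have hunion : ∀ H, ZE J₁ α θ β Λ (fs H) (fun A => 0 ∈ A) ≤
      ∑ l ∈ S, ZE J₁ α θ β Λ (fs H)
        (fun A => g l ≤ WW J₁ α A - WW J₁ α (symmDiff A (IS N l))) := by
    intro H
    unfold ZE
    rw [Finset.sum_comm]
    refine Finset.sum_le_sum fun A hA => ?_
    have hw := wt_pos J₁ α θ β (fs H) A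
    have hnn : ∀ l ∈ S, (0 : ℝ) ≤ if g l ≤ WW J₁ α A - WW J₁ α (symmDiff A (IS N l)) then
        wt J₁ α θ β (fs H) A else 0 := by
      intro l _; split_ifs
      · exact hw.le
      · exact le_rfl
    by_cases h0 : (0 : ℤ) ∈ A
    · have hlS : L A ∈ S := Finset.mem_image_of_mem _ (Finset.mem_filter.2 ⟨hA, h0⟩)
      refine le_trans (le_of_eq ?_) (Finset.single_le_sum hnn hlS)
      obtain ⟨a1, a2, a3⟩ := hL A (Finset.mem_powerset.1 hA) h0
      have hc := mcost_ge _ a1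
      have hgl : g (L A) ≤ WW J₁ α A - WW J₁ α (symmDiff A (IS N (L A))) :=
        max_le a2 (Real.sqrt_le_iff.2 ⟨by linarith, a3⟩)
      rw [if_pos h0, if_pos hgl]
    · rw [if_neg h0]
      exact Finset.sum_nonneg hnn
  have hev : ∀ l ∈ S, ∑ H ∈ Λ.powerset, ZE J₁ α θ β Λ (fs H)
        (fun A => g l ≤ WW J₁ α A - WW J₁ α (symmDiff A (IS N l))) / ZZ J₁ α θ β Λ (fs H) ≤
      2 ^ Λ.card * (Real.exp (-(4 * B)) * vl l) := by
    intro l hl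
    have hc := mcost_ge l (hSne l hl)
    have hsq : 8 * mcost l * (IS N l).card ≤ g l ^ 2 := by
      have h0 : 0 ≤ 8 * mcost l * (IS N l).card := by positivity
      calc 8 * mcost l * (IS N l).card = Real.sqrt (8 * mcost l * (IS N l).card) ^ 2 :=
            (Real.sq_sqrt h0).symm
        _ ≤ g l ^ 2 := pow_le_pow_left₀ (Real.sqrt_nonneg _) (le_max_right _ _) 2
    refine (annealed_event J₁ α θ β (g l) (8 * mcost l) hθ (by linarith) (by linarith) Λ (IS N l)
      (Finset.filter_subset _ _) (le_max_left _ _) hsq).trans ?_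
    refine mul_le_mul_of_nonneg_left ?_ (by positivity)
    unfold vl
    rw [← Real.exp_add, Real.exp_le_exp, ← hB]
    nlinarith
  have hp : (0 : ℝ) < 2 ^ Λ.card := by positivity
  rw [one_div, inv_mul_le_iff₀ hp]
  calc ∑ H ∈ Λ.powerset, ZE J₁ α θ β Λ (fs H) (fun A => 0 ∈ A) / ZZ J₁ α θ β Λ (fs H)
      ≤ ∑ H ∈ Λ.powerset, ∑ l ∈ S, ZE J₁ α θ β Λ (fs H)
        (fun A => g l ≤ WW J₁ α A - WW J₁ α (symmDiff A (IS N l))) / ZZ J₁ α θ β Λ (fs H) := by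
        refine Finset.sum_le_sum fun H _ => ?_
        rw [← Finset.sum_div]
        exact div_le_div_of_nonneg_right (hunion H) (ZZ_pos _ _ _ _ _ _).le
    _ = ∑ l ∈ S, ∑ H ∈ Λ.powerset, ZE J₁ α θ β Λ (fs H)
        (fun A => g l ≤ WW J₁ α A - WW J₁ α (symmDiff A (IS N l))) / ZZ J₁ α θ β Λ (fs H) :=
        Finset.sum_comm
    _ ≤ ∑ l ∈ S, 2 ^ Λ.card * (Real.exp (-(4 * B)) * vl l) := Finset.sum_le_sum hev
    _ = 2 ^ Λ.card * (Real.exp (-(4 * B)) * ∑ l ∈ S, vl l) := by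
        rw [Finset.mul_sum, Finset.mul_sum]
    _ ≤ 2 ^ Λ.card * (Real.exp (-(4 * B)) * 1) := by
        have := lists_sum S hSne
        gcongr
    _ = _ := by rw [mul_one]

/-- **Annealed Peierls estimate.**  For `α ∈ (1/2, ln 3/ln 2 - 1)` and
`ζ = 1 - 2(2^α - 1) > 0`, there exist `θ₀(α) > 0`, `β₀(α) > 0` and a large enough value of the
nearest neighbour coupling `J(1)` such that for all `0 < θ ≤ θ₀`, `β ≥ β₀` and every finite
`Λ ∋ 0`, the annealed probability that the spin at the origin is `-1` under the plus boundary
condition Gibbs measure is at most `e^{-b̄/100}`, with `b̄ = min(βζ/4, ζ²/(2¹⁰θ²))`. -/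
theorem annealed_minus_spin_at_origin
    (α : ℝ) (hα₁ : 1 / 2 < α) (hα₂ : α < Real.log 3 / Real.log 2 - 1)
    (ζ : ℝ) (hζdef : ζ = 1 - 2 * ((2 : ℝ) ^ α - 1)) :
    0 < ζ ∧
    ∃ θ₀ > (0 : ℝ), ∃ β₀ > (0 : ℝ), ∃ J₁min : ℝ, ∀ J₁ : ℝ, J₁min ≤ J₁ →
      ∀ θ : ℝ, 0 < θ → θ ≤ θ₀ → ∀ β : ℝ, β₀ ≤ β →
      ∀ Λ : Finset ℤ, ∀ h0 : (0 : ℤ) ∈ Λ,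
        fieldE Λ (fun h =>
            gibbs J₁ α θ 1 β Λ h (fun σ => spin (σ ⟨0, h0⟩) = -1))
          ≤ Real.exp (-(min (β * ζ / 4) (ζ ^ 2 / (2 ^ 10 * θ ^ 2))) / 100) := by
  have hl2 : 0 < Real.log 2 := Real.log_pos (by norm_num)
  have hlt : (2 : ℝ) ^ (α + 1) < 3 := by
    rw [Real.rpow_def_of_pos (by norm_num)]
    rw [← Real.exp_log (show (0 : ℝ) < 3 by norm_num), Real.exp_lt_exp]
    have : α + 1 < Real.log 3 / Real.log 2 := by linarith
    rw [lt_div_iff₀ hl2] at this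
    linarith
  have h2a : (2 : ℝ) ^ (α + 1) = 2 ^ α * 2 := Real.rpow_add_one (by norm_num) α
  have hζ0 : 0 < ζ := by rw [hζdef]; linarith
  have h1a : (1 : ℝ) ≤ 2 ^ α := Real.one_le_rpow (by norm_num) (by linarith)
  have hζ1 : ζ ≤ 1 := by rw [hζdef]; linarith
  have hα1 : α < 1 := by
    by_contra h
    push Not at h
    have : (2 : ℝ) ^ (1 : ℝ) ≤ 2 ^ α := Real.rpow_le_rpow_of_exponent_le (by norm_num) h
    rw [Real.rpow_one] at this
    linarith
  refine ⟨hζ0, 1 / 2, by norm_num, 1, by norm_num, ?_⟩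
  obtain ⟨J₀, hJ₀⟩ := deterministic α ζ 8 hα₁ hα1 hζ0 hζdef (by norm_num)
  refine ⟨J₀, ?_⟩
  intro J₁ hJ θ hθ hθ2 β hβ Λ h0
  obtain ⟨hJ0, hdet⟩ := hJ₀ J₁ hJ
  have hβ0 : 0 < β := by linarith
  obtain ⟨N, hN⟩ : ∃ N : ℕ, Λ ⊆ Finset.Icc (-(N : ℤ)) N := by
    refine ⟨∑ x ∈ Λ, x.natAbs, ?_⟩
    intro x hx
    have : x.natAbs ≤ ∑ x ∈ Λ, x.natAbs :=
      Finset.single_le_sum (f := fun x : ℤ => x.natAbs) (fun _ _ => Nat.zero_le _) hx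
    rw [Finset.mem_Icc]
    omega
  refine (to_big J₁ α θ β hα1 hJ0 hβ0.le Λ _ hN h0).trans ?_
  refine (interval_bound J₁ α θ β hθ hθ2 hβ N (hdet N)).trans ?_
  rw [Real.exp_le_exp, neg_div, neg_le_neg_iff, div_le_iff₀ (by norm_num)]
  have hm : min (β * ζ / 4) (ζ ^ 2 / (2 ^ 10 * θ ^ 2)) ≤ min β (1 / (2 * θ ^ 2)) := by
    refine min_le_min ?_ ?_
    · nlinarith
    · rw [div_le_div_iff₀ (by positivity) (by positivity)]
      have : ζ ^ 2 ≤ 1 := by nlinarith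
      nlinarith [sq_nonneg θ]
  have hB0 : 0 ≤ min β (1 / (2 * θ ^ 2)) := le_min hβ0.le (by positivity)
  linarith
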